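/- Let X₀, X₁ be n-dimensional Banach lattices, [E₀,E₁] a finite-dimensional interpolation couple, and 0 < θ < 1. Then d_θ[X₀(E₀), X₁(E₁)] ≤ √2 · C₂([E₀,E₁]_θ) · M_(2)(X₀)^{1-θ} · M_(2)(X₁)^{θ} · d_θ[ℓ₂ⁿ(E₀), ℓ₂ⁿ(E₁)], where for a finite-dimensional interpolation couple [M₀,M₁], d_θ[M₀,M₁] denotes the norm of the identity L(ℓ₂,[M₀,M₁]_θ) → [L(ℓ₂,M₀), L(ℓ₂,M₁)]_θ. -/

import Mathlib

open Complex MeasureTheory Finset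

noncomputable section

namespace Paper

/-- The closed unit strip in the complex plane. -/
def Strip : Set ℂ := {z : ℂ | 0 ≤ z.re ∧ z.re ≤ 1}

/-- The open unit strip in the complex plane. -/
def OStrip : Set ℂ := {z : ℂ | 0 < z.re ∧ z.re < 1}

/-- `N` is a norm on the complex vector space `V`. -/
def IsNormC {V : Type*} [AddCommGroup V] [Module ℂ V] (N : V → ℝ) : Prop :=
  (∀ x, 0 ≤ N x) ∧ (∀ x, N x = 0 → x = 0) ∧
  (∀ (c : ℂ) (x), N (c • x) = ‖c‖ * N x) ∧ (∀ x y, N (x + y) ≤ N x + N y)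

/-- `N` is a lattice norm on `ℝⁿ`. -/
def IsLatticeNorm {n : ℕ} (N : (Fin n → ℝ) → ℝ) : Prop :=
  (∀ x, 0 ≤ N x) ∧ (∀ x, N x = 0 → x = 0) ∧
  (∀ (c : ℝ) (x), N (c • x) = |c| * N x) ∧ (∀ x y, N (x + y) ≤ N x + N y) ∧
  (∀ x y, (∀ i, |x i| ≤ |y i|) → N x ≤ N y)

/-- The `r`-th power `X^r` of a lattice norm: `‖x‖_{X^r} = ‖ |x|^{1/r} ‖_X^r`. -/
def powNorm {n : ℕ} (r : ℝ) (N : (Fin n → ℝ) → ℝ) (x : Fin n → ℝ) : ℝ :=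
  (N fun i => |x i| ^ (1 / r)) ^ r

/-- `N` is `p`-convex with constant `C`. -/
def ConvexWith {n : ℕ} (p C : ℝ) (N : (Fin n → ℝ) → ℝ) : Prop :=
  ∀ (m : ℕ) (x : Fin m → Fin n → ℝ),
    N (fun j => (∑ i, |x i j| ^ p) ^ (1 / p)) ≤ C * (∑ i, N (x i) ^ p) ^ (1 / p)

/-- `N` is `p`-concave with constant `C`. -/
def ConcaveWith {n : ℕ} (p C : ℝ) (N : (Fin n → ℝ) → ℝ) : Prop :=
  ∀ (m : ℕ) (x : Fin m → Fin n → ℝ),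
    (∑ i, N (x i) ^ p) ^ (1 / p) ≤ C * N (fun j => (∑ i, |x i j| ^ p) ^ (1 / p))

/-- The dual lattice norm on `ℝⁿ`. -/
def dualNR {n : ℕ} (N : (Fin n → ℝ) → ℝ) (y : Fin n → ℝ) : ℝ :=
  sSup {r : ℝ | ∃ x, N x ≤ 1 ∧ r = |∑ i, x i * y i|}

/-- The Calderón product norm `X₀^{1-θ}X₁^θ` on `ℝⁿ`. -/
def calNorm {n : ℕ} (θ : ℝ) (N₀ N₁ : (Fin n → ℝ) → ℝ) (f : Fin n → ℝ) : ℝ :=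
  sInf {c : ℝ | ∃ g h : Fin n → ℝ, (∀ i, |f i| = |g i| ^ (1 - θ) * |h i| ^ θ) ∧
    c = N₀ g ^ (1 - θ) * N₁ h ^ θ}

/-- The complex interpolation norm `[N₀,N₁]_θ`, computed via analytic functions
of finite type `z ↦ ∑ φᵢ(z) • vᵢ` on the strip (which, by density, gives the
complex interpolation norm on the intersection for couples with dense intersection). -/
def interpN {D : Type*} [AddCommGroup D] [Module ℂ D]
    (θ : ℝ) (N₀ N₁ : D → ℝ) (x : D) : ℝ :=
  sInf {c : ℝ | ∃ (m : ℕ) (φ : Fin m → ℂ → ℂ) (v : Fin m → D),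
    (∀ i, ContinuousOn (φ i) Strip) ∧
    (∀ i, DifferentiableOn ℂ (φ i) OStrip) ∧
    (∀ i, ∃ B : ℝ, ∀ z ∈ Strip, ‖φ i z‖ ≤ B) ∧
    (∑ i, φ i (θ : ℂ) • v i) = x ∧
    (∀ t : ℝ, N₀ (∑ i, φ i (Complex.I * t) • v i) ≤ c) ∧
    (∀ t : ℝ, N₁ (∑ i, φ i (1 + Complex.I * t) • v i) ≤ c)}

/-- Operator "norm" of a map with respect to given norm functions. -/
def opN {X Y : Type*} (NX : X → ℝ) (NY : Y → ℝ) (T : X → Y) : ℝ :=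
  sSup {r : ℝ | ∃ x, NX x ≤ 1 ∧ r = NY (T x)}

/-- The Hilbert space `ℓ₂`. -/
abbrev Hilb := lp (fun _ : ℕ => ℂ) 2

def hilbNorm (x : Hilb) : ℝ := ‖x‖

/-- `d_θ[M₀,M₁]`: the norm of the identity
`L(ℓ₂,[M₀,M₁]_θ) → [L(ℓ₂,M₀),L(ℓ₂,M₁)]_θ`. -/
def dTheta {V : Type*} [NormedAddCommGroup V] [NormedSpace ℂ V]
    (θ : ℝ) (N₀ N₁ : V → ℝ) : ℝ :=
  sSup {r : ℝ | ∃ T : Hilb →L[ℂ] V,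
    opN hilbNorm (interpN θ N₀ N₁) ⇑T ≤ 1 ∧
    r = interpN θ (fun S : Hilb →L[ℂ] V => opN hilbNorm N₀ ⇑S)
        (fun S : Hilb →L[ℂ] V => opN hilbNorm N₁ ⇑S) T}

/-- Rademacher average `(2^{-m} ∑_ε ‖∑ ±xᵢ‖²)`. -/
def radAvg {V : Type*} [AddCommGroup V] (N : V → ℝ) {m : ℕ} (x : Fin m → V) : ℝ :=
  ((2 : ℝ) ^ m)⁻¹ * ∑ ε : Fin m → Bool, N (∑ i, if ε i then x i else -x i) ^ 2

/-- `N` has (Rademacher) type 2 with constant `C`. -/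
def Type2With {V : Type*} [AddCommGroup V] (N : V → ℝ) (C : ℝ) : Prop :=
  ∀ (m : ℕ) (x : Fin m → V), Real.sqrt (radAvg N x) ≤ C * Real.sqrt (∑ i, N (x i) ^ 2)

/-- `N` has (Rademacher) cotype 2 with constant `C`. -/
def Cotype2With {V : Type*} [AddCommGroup V] (N : V → ℝ) (C : ℝ) : Prop :=
  ∀ (m : ℕ) (x : Fin m → V), Real.sqrt (∑ i, N (x i) ^ 2) ≤ C * Real.sqrt (radAvg N x)

/-- The injective tensor norm of two norm functions. -/
def injN {V W : Type*} [AddCommGroup V] [Module ℂ V] [AddCommGroup W] [Module ℂ W]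
    (NV : V → ℝ) (NW : W → ℝ) (z : TensorProduct ℂ V W) : ℝ :=
  sSup {r : ℝ | ∃ (φ : V →ₗ[ℂ] ℂ) (ψ : W →ₗ[ℂ] ℂ),
    (∀ x, ‖φ x‖ ≤ NV x) ∧ (∀ y, ‖ψ y‖ ≤ NW y) ∧
    r = ‖TensorProduct.lift (((LinearMap.mul ℂ ℂ).comp φ).compl₂ ψ) z‖}

/-- Dual norm on linear functionals. -/
def dualNC {V : Type*} [AddCommGroup V] [Module ℂ V] (N : V → ℝ) (φ : V →ₗ[ℂ] ℂ) : ℝ :=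
  sSup {r : ℝ | ∃ x, N x ≤ 1 ∧ r = ‖φ x‖}

/-- The space of bounded linear functionals (dual space of the completion). -/
def BddDual {V : Type*} [AddCommGroup V] [Module ℂ V] (N : V → ℝ) :
    Submodule ℂ (V →ₗ[ℂ] ℂ) where
  carrier := {φ | ∃ c : ℝ, ∀ x, ‖φ x‖ ≤ c * N x}
  zero_mem' := ⟨0, by simp⟩
  add_mem' := by
    rintro φ ψ ⟨c, hc⟩ ⟨d, hd⟩
    exact ⟨c + d, fun x => by
      have h1 := hc x; have h2 := hd x
      calc ‖(φ + ψ) x‖ = ‖φ x + ψ x‖ := by simp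
        _ ≤ ‖φ x‖ + ‖ψ x‖ := norm_add_le _ _
        _ ≤ (c + d) * N x := by rw [add_mul]; exact add_le_add h1 h2⟩
  smul_mem' := by
    rintro a φ ⟨c, hc⟩
    exact ⟨‖a‖ * c, fun x => by
      have : ‖(a • φ) x‖ = ‖a‖ * ‖φ x‖ := by simp [norm_smul]
      rw [this, mul_assoc]
      exact mul_le_mul_of_nonneg_left (hc x) (norm_nonneg a)⟩

/-- Strictly simple functions with values in `V`: the span of
`v`-valued indicators of finite-measure measurable sets. -/
def SimpleSub {Ω : Type*} [MeasurableSpace Ω] (μ : Measure Ω)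
    (V : Type*) [AddCommGroup V] [Module ℂ V] : Submodule ℂ (Ω → V) :=
  Submodule.span ℂ {f | ∃ (s : Set Ω) (v : V), MeasurableSet s ∧ μ s < ⊤ ∧
    f = s.indicator fun _ => v}

/-- A Banach function space over a measure `μ`, with `K`-valued functions. -/
structure BFS (Ω : Type*) [MeasurableSpace Ω] (μ : Measure Ω) (K : Type*) [RCLike K] where
  mem : (Ω → K) → Prop
  nrm : (Ω → K) → ℝ
  mem_zero : mem 0
  mem_add : ∀ f g, mem f → mem g → mem (f + g)
  mem_smul : ∀ (c : K) (f), mem f → mem (c • f)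
  mem_meas : ∀ f, mem f → AEStronglyMeasurable f μ
  ideal : ∀ f g, AEStronglyMeasurable f μ → mem g →
    (∀ᵐ ω ∂μ, ‖f ω‖ ≤ ‖g ω‖) → mem f ∧ nrm f ≤ nrm g
  nrm_nonneg : ∀ f, 0 ≤ nrm f
  nrm_eq_zero : ∀ f, mem f → nrm f = 0 → f =ᵐ[μ] 0
  nrm_add : ∀ f g, mem f → mem g → nrm (f + g) ≤ nrm f + nrm g
  nrm_smul : ∀ (c : K) (f), nrm (c • f) = ‖c‖ * nrm f
  mem_indicator : ∀ s : Set Ω, MeasurableSet s → μ s < ⊤ →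
    mem (s.indicator fun _ => 1)
  complete : ∀ f : ℕ → Ω → K, (∀ k, mem (f k)) →
    (∀ ε : ℝ, 0 < ε → ∃ N : ℕ, ∀ p q, N ≤ p → N ≤ q → nrm (f p - f q) < ε) →
    ∃ g, mem g ∧ ∀ ε : ℝ, 0 < ε → ∃ N : ℕ, ∀ p, N ≤ p → nrm (f p - g) < ε

variable {Ω : Type*} [MeasurableSpace Ω] {μ : Measure Ω} {K : Type*} [RCLike K]

/-- `X` is `r`-convex with constant `C`. -/
def BFS.RConvexWith (X : BFS Ω μ K) (r C : ℝ) : Prop :=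
  ∀ (m : ℕ) (f : Fin m → Ω → K), (∀ i, X.mem (f i)) →
    X.mem (fun ω => ((((∑ i, ‖f i ω‖ ^ r) ^ (1 / r) : ℝ) : K))) ∧
    X.nrm (fun ω => ((((∑ i, ‖f i ω‖ ^ r) ^ (1 / r) : ℝ) : K))) ≤
      C * (∑ i, X.nrm (f i) ^ r) ^ (1 / r)

/-- `X` is `r`-concave with constant `C`. -/
def BFS.RConcaveWith (X : BFS Ω μ K) (r C : ℝ) : Prop :=
  ∀ (m : ℕ) (f : Fin m → Ω → K), (∀ i, X.mem (f i)) →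
    (∑ i, X.nrm (f i) ^ r) ^ (1 / r) ≤
      C * X.nrm (fun ω => ((((∑ i, ‖f i ω‖ ^ r) ^ (1 / r) : ℝ) : K)))

/-- Vector-valued lattice norm `X(E)` on `Eⁿ`. -/
def vecLatNorm {n : ℕ} {V : Type*} (N : (Fin n → ℝ) → ℝ) (NE : V → ℝ)
    (x : Fin n → V) : ℝ := N fun i => NE (x i)

/-- The `ℓ₂ⁿ(E)` norm. -/
def l2nNorm {n : ℕ} {V : Type*} (NE : V → ℝ) (x : Fin n → V) : ℝ :=
  Real.sqrt (∑ i, NE (x i) ^ 2)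

/-- The sign `±1` attached to a Boolean. -/
def boolSign (b : Bool) : ℝ := if b then 1 else -1

/-- Uniform average over the discrete cube. -/
def cubeAvg {m : ℕ} (g : (Fin m → Bool) → ℝ) : ℝ := ((2 : ℝ) ^ m)⁻¹ * ∑ ε, g ε

/-- Flip the `j`-th coordinate of a point of the discrete cube. -/
def flipAt {m : ℕ} (j : Fin m) (ε : Fin m → Bool) : Fin m → Bool :=
  Function.update ε j (!ε j)

/-- The Dirichlet energy on the discrete cube. -/
def cubeEnergy {m : ℕ} (g : (Fin m → Bool) → ℝ) : ℝ :=
  (1 / 4) * ∑ j, cubeAvg fun ε => (g ε - g (flipAt j ε)) ^ 2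

lemma cubeAvg_add {m : ℕ} (f g : (Fin m → Bool) → ℝ) :
    cubeAvg (fun ε => f ε + g ε) = cubeAvg f + cubeAvg g := by
  simp [cubeAvg, Finset.sum_add_distrib, mul_add]

lemma cubeAvg_const_mul {m : ℕ} (c : ℝ) (g : (Fin m → Bool) → ℝ) :
    cubeAvg (fun ε => c * g ε) = c * cubeAvg g := by
  simp only [cubeAvg, ← Finset.mul_sum]; ring

lemma cubeAvg_mono {m : ℕ} {f g : (Fin m → Bool) → ℝ} (h : ∀ ε, f ε ≤ g ε) :
    cubeAvg f ≤ cubeAvg g := by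
  unfold cubeAvg
  gcongr with ε
  exact h ε

lemma cubeAvg_const {m : ℕ} (c : ℝ) : cubeAvg (fun _ : Fin m → Bool => c) = c := by
  simp [cubeAvg]

lemma cubeAvg_succ {m : ℕ} (g : (Fin (m + 1) → Bool) → ℝ) :
    cubeAvg g = (cubeAvg (fun ε => g (Fin.cons true ε)) +
      cubeAvg (fun ε => g (Fin.cons false ε))) / 2 := by
  have h : ∑ ε, g ε = (∑ ε, g (Fin.cons true ε)) + ∑ ε, g (Fin.cons false ε) := by
    rw [← (Fin.consEquiv (fun _ : Fin (m + 1) => Bool)).sum_comp, Fintype.sum_prod_type]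
    simp [Fin.consEquiv]
  rw [cubeAvg, cubeAvg, cubeAvg, h, pow_succ]
  field_simp

lemma cubeAvg_sq_le {m : ℕ} (g : (Fin m → Bool) → ℝ) :
    cubeAvg g ^ 2 ≤ cubeAvg fun ε => g ε ^ 2 := by
  have h : cubeAvg (fun ε => (g ε - cubeAvg g) ^ 2) =
      cubeAvg (fun ε => g ε ^ 2) - cubeAvg g ^ 2 := by
    have : (fun ε => (g ε - cubeAvg g) ^ 2) =
        fun ε => (g ε ^ 2 + (-2 * cubeAvg g) * g ε) + cubeAvg g ^ 2 := by
      funext ε; ring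
    rw [this, cubeAvg_add, cubeAvg_add, cubeAvg_const_mul, cubeAvg_const]
    ring
  have h0 : 0 ≤ cubeAvg (fun ε => (g ε - cubeAvg g) ^ 2) := by
    rw [← cubeAvg_const (m := m) 0]
    exact cubeAvg_mono fun ε => sq_nonneg _
  linarith

lemma flipAt_zero_cons {m : ℕ} (b : Bool) (ε : Fin m → Bool) :
    flipAt 0 (Fin.cons b ε : Fin (m + 1) → Bool) = Fin.cons (!b) ε := by
  simp [flipAt, Fin.update_cons_zero]

lemma flipAt_succ_cons {m : ℕ} (j : Fin m) (b : Bool) (ε : Fin m → Bool) :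
    flipAt j.succ (Fin.cons b ε : Fin (m + 1) → Bool) = Fin.cons b (flipAt j ε) := by
  simp [flipAt, Fin.cons_update]

/-- The symmetric part of `g` in the first coordinate. -/
def symPart {m : ℕ} (g : (Fin (m + 1) → Bool) → ℝ) (ε : Fin m → Bool) : ℝ :=
  (g (Fin.cons true ε) + g (Fin.cons false ε)) / 2

/-- The antisymmetric part of `g` in the first coordinate. -/
def antPart {m : ℕ} (g : (Fin (m + 1) → Bool) → ℝ) (ε : Fin m → Bool) : ℝ :=
  (g (Fin.cons true ε) - g (Fin.cons false ε)) / 2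

lemma cubeAvg_symPart {m : ℕ} (g : (Fin (m + 1) → Bool) → ℝ) :
    cubeAvg (symPart g) = cubeAvg g := by
  rw [cubeAvg_succ, ← cubeAvg_add, div_eq_inv_mul, ← cubeAvg_const_mul]
  congr 1; funext ε; simp only [symPart]; ring

lemma cubeAvg_sq_split {m : ℕ} (g : (Fin (m + 1) → Bool) → ℝ) :
    cubeAvg (fun ε => g ε ^ 2) =
      cubeAvg (fun ε => symPart g ε ^ 2) + cubeAvg (fun ε => antPart g ε ^ 2) := by
  rw [cubeAvg_succ, ← cubeAvg_add, ← cubeAvg_add, div_eq_inv_mul, ← cubeAvg_const_mul]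
  congr 1; funext ε; simp only [symPart, antPart]; ring

lemma cubeEnergy_split {m : ℕ} (g : (Fin (m + 1) → Bool) → ℝ) :
    cubeEnergy g = cubeEnergy (symPart g) + cubeEnergy (antPart g) +
      cubeAvg (fun ε => antPart g ε ^ 2) := by
  unfold cubeEnergy
  rw [Fin.sum_univ_succ, mul_add, add_comm]
  congr 1
  · rw [← mul_add, ← Finset.sum_add_distrib]
    congr 1
    refine Finset.sum_congr rfl fun j _ => ?_
    rw [cubeAvg_succ, ← cubeAvg_add, ← cubeAvg_add, div_eq_inv_mul, ← cubeAvg_const_mul]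
    congr 1; funext ε
    simp only [flipAt_succ_cons, symPart, antPart]; ring
  · rw [cubeAvg_succ, ← cubeAvg_add, div_eq_inv_mul _ (2 : ℝ), ← cubeAvg_const_mul,
      ← cubeAvg_const_mul]
    congr 1; funext ε
    simp only [flipAt_zero_cons, antPart, Bool.not_true, Bool.not_false]; ring

/-- The Poincaré inequality on the discrete cube. -/
lemma cube_poincare {m : ℕ} (g : (Fin m → Bool) → ℝ) :
    cubeAvg (fun ε => g ε ^ 2) - cubeAvg g ^ 2 ≤ cubeEnergy g := by
  induction m with
  | zero => simp [cubeAvg, cubeEnergy]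
  | succ m ih =>
    have h1 := ih (symPart g)
    have h2 : 0 ≤ cubeEnergy (antPart g) := by
      have := ih (antPart g)
      have := cubeAvg_sq_le (antPart g)
      linarith
    rw [cubeAvg_sq_split, cubeEnergy_split, ← cubeAvg_symPart g]
    linarith

/-- The Poincaré inequality with spectral gap two, corrected by the first Fourier level. -/
lemma cube_poincare_two {m : ℕ} (g : (Fin m → Bool) → ℝ) :
    2 * (cubeAvg (fun ε => g ε ^ 2) - cubeAvg g ^ 2) ≤
      cubeEnergy g + ∑ j, cubeAvg (fun ε => boolSign (ε j) * g ε) ^ 2 := by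
  induction m with
  | zero => simp [cubeAvg, cubeEnergy]
  | succ m ih =>
    have h1 := ih (symPart g)
    have h2 := cube_poincare (antPart g)
    have h3 : cubeAvg (fun ε => boolSign (ε 0) * g ε) = cubeAvg (antPart g) := by
      rw [cubeAvg_succ, ← cubeAvg_add, div_eq_inv_mul, ← cubeAvg_const_mul]
      congr 1; funext ε
      simp only [antPart, boolSign, Fin.cons_zero]; simp; ring
    have h4 : ∀ j : Fin m, cubeAvg (fun ε => boolSign (ε j.succ) * g ε) =
        cubeAvg (fun ε => boolSign (ε j) * symPart g ε) := by
      intro j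
      rw [cubeAvg_succ, ← cubeAvg_add, div_eq_inv_mul, ← cubeAvg_const_mul]
      congr 1; funext ε
      simp only [symPart, Fin.cons_succ]; ring
    rw [Fin.sum_univ_succ, h3, Finset.sum_congr rfl fun j _ => by rw [h4 j],
      cubeAvg_sq_split, cubeEnergy_split, ← cubeAvg_symPart g]
    linarith

/-- The signed sum `∑ ±xᵢ`. -/
def signSum {V : Type*} [AddCommGroup V] {m : ℕ} (x : Fin m → V) (ε : Fin m → Bool) : V :=
  ∑ i, if ε i then x i else -x i

lemma cubeAvg_comp_equiv {m : ℕ} (e : (Fin m → Bool) ≃ (Fin m → Bool))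
    (g : (Fin m → Bool) → ℝ) : cubeAvg (fun ε => g (e ε)) = cubeAvg g := by
  rw [cubeAvg, cubeAvg, e.sum_comp]

/-- Flipping a coordinate, as an involution of the cube. -/
def flipEquiv {m : ℕ} (j : Fin m) : (Fin m → Bool) ≃ (Fin m → Bool) :=
  Function.Involutive.toPerm (flipAt j) fun ε => by simp [flipAt]

/-- Flipping all coordinates, as an involution of the cube. -/
def negEquiv (m : ℕ) : (Fin m → Bool) ≃ (Fin m → Bool) :=
  Function.Involutive.toPerm (fun ε i => !ε i) fun ε => by simp

lemma negEquiv_apply {m : ℕ} (ε : Fin m → Bool) (i : Fin m) : negEquiv m ε i = !ε i := rfl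

/-- The Kahane inequality between first and second moments, with the optimal constant. -/
lemma kahane_two {V : Type*} [AddCommGroup V] [Module ℝ V] (N : V → ℝ)
    (h0 : ∀ x, 0 ≤ N x) (hs : ∀ (c : ℝ) x, N (c • x) = |c| * N x)
    (ha : ∀ x y, N (x + y) ≤ N x + N y) {m : ℕ} (x : Fin m → V) :
    cubeAvg (fun ε => N (signSum x ε) ^ 2) ≤ 2 * cubeAvg (fun ε => N (signSum x ε)) ^ 2 := by
  set h : (Fin m → Bool) → ℝ := fun ε => N (signSum x ε) with hh
  have hneg : ∀ v, N (-v) = N v := fun v => by simpa using hs (-1) v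
  have hzero : N 0 = 0 := by simpa using hs 0 0
  have heven : ∀ ε, h (negEquiv m ε) = h ε := by
    intro ε
    rw [hh]
    simp only
    rw [← hneg (signSum x ε)]
    congr 1
    simp only [signSum, negEquiv_apply, ← Finset.sum_neg_distrib]
    refine Finset.sum_congr rfl fun i _ => ?_
    by_cases hb : ε i = true <;> simp [hb]
  have hlev : ∀ j, cubeAvg (fun ε => boolSign (ε j) * h ε) = 0 := by
    intro j
    have h1 := cubeAvg_comp_equiv (negEquiv m) (fun ε => boolSign (ε j) * h ε)
    simp only [heven] at h1
    have h2 : (fun ε => boolSign (negEquiv m ε j) * h ε) =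
        fun ε => (-1) * (boolSign (ε j) * h ε) := by
      funext ε
      simp only [negEquiv_apply, boolSign]
      by_cases hb : ε j = true <;> simp [hb]
    rw [h2, cubeAvg_const_mul] at h1
    linarith
  have hsum : ∀ ε, ∑ j, signSum x (flipAt j ε) = ((m : ℝ) - 2) • signSum x ε := by
    intro ε
    have : ∀ j, signSum x (flipAt j ε) =
        signSum x ε - (2 : ℝ) • (if ε j then x j else -x j) := by
      intro j
      rw [sub_eq_add_neg, ← neg_smul]
      simp only [signSum]
      rw [← Finset.add_sum_erase _ _ (Finset.mem_univ j),
        ← Finset.add_sum_erase (a := j) _ (fun i => if ε i then x i else -x i) (Finset.mem_univ j)]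
      have : ∑ i ∈ univ.erase j, (if flipAt j ε i then x i else -x i) =
          ∑ i ∈ univ.erase j, (if ε i then x i else -x i) := by
        refine Finset.sum_congr rfl fun i hi => ?_
        simp [flipAt, Function.update_of_ne (Finset.ne_of_mem_erase hi)]
      rw [this]
      cases hb : ε j <;> simp [flipAt, hb, two_smul] <;> abel
    simp only [this, Finset.sum_sub_distrib, ← Finset.smul_sum]
    simp [sub_smul, signSum, Nat.cast_smul_eq_nsmul]
  have hsumN : ∀ (s : Finset (Fin m)) (v : Fin m → V), N (∑ j ∈ s, v j) ≤ ∑ j ∈ s, N (v j) := by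
    intro s v
    induction s using Finset.induction_on with
    | empty => simp [hzero]
    | insert a s has ih =>
      rw [Finset.sum_insert has, Finset.sum_insert has]
      exact (ha _ _).trans (by linarith)
  have hflip : ∀ ε, ((m : ℝ) - 2) * h ε ≤ ∑ j, h (flipAt j ε) := by
    intro ε
    calc ((m : ℝ) - 2) * h ε ≤ |(m : ℝ) - 2| * h ε :=
          mul_le_mul_of_nonneg_right (le_abs_self _) (h0 _)
      _ = N (∑ j, signSum x (flipAt j ε)) := by rw [hsum, hs]
      _ ≤ _ := hsumN _ _
  have hen : cubeEnergy h ≤ cubeAvg (fun ε => h ε ^ 2) := by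
    have h1 : ∀ j, cubeAvg (fun ε => (h ε - h (flipAt j ε)) ^ 2) =
        2 * cubeAvg (fun ε => h ε ^ 2) + (-2) * cubeAvg (fun ε => h ε * h (flipAt j ε)) := by
      intro j
      have h2 : cubeAvg (fun ε => h (flipAt j ε) ^ 2) = cubeAvg (fun ε => h ε ^ 2) :=
        cubeAvg_comp_equiv (flipEquiv j) (fun ε => h ε ^ 2)
      have h3 : (fun ε => (h ε - h (flipAt j ε)) ^ 2) = fun ε =>
          (h ε ^ 2 + h (flipAt j ε) ^ 2) + (-2) * (h ε * h (flipAt j ε)) := by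
        funext ε; ring
      rw [h3, cubeAvg_add, cubeAvg_add, cubeAvg_const_mul, h2]; ring
    have h4 : ∑ j, cubeAvg (fun ε => h ε * h (flipAt j ε)) =
        cubeAvg (fun ε => h ε * ∑ j, h (flipAt j ε)) := by
      simp only [cubeAvg, ← Finset.mul_sum]
      rw [Finset.sum_comm]
      simp only [Finset.mul_sum]
    have h5 : cubeAvg (fun ε => ((m : ℝ) - 2) * h ε ^ 2) ≤
        cubeAvg (fun ε => h ε * ∑ j, h (flipAt j ε)) := by
      refine cubeAvg_mono fun ε => ?_
      have := mul_le_mul_of_nonneg_left (hflip ε) (h0 (signSum x ε))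
      calc ((m : ℝ) - 2) * h ε ^ 2 = h ε * (((m : ℝ) - 2) * h ε) := by ring
        _ ≤ _ := this
    rw [cubeAvg_const_mul] at h5
    rw [cubeEnergy]
    simp only [h1, Finset.sum_add_distrib, ← Finset.mul_sum, h4]
    simp
    linarith
  have := cube_poincare_two h
  simp only [hlev] at this
  simp at this
  linarith

/-- The parallelogram identity over all signs, as an inequality for first moments. -/
lemma cubeAvg_norm_signSum_le {H : Type*} [NormedAddCommGroup H] [InnerProductSpace ℂ H]
    {m : ℕ} (x : Fin m → H) :
    cubeAvg (fun ε => ‖signSum x ε‖) ≤ Real.sqrt (∑ i, ‖x i‖ ^ 2) := by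
  have key : ∀ {m : ℕ} (x : Fin m → H) (y : H),
      cubeAvg (fun ε => ‖y + signSum x ε‖ ^ 2) = ‖y‖ ^ 2 + ∑ i, ‖x i‖ ^ 2 := by
    intro m
    induction m with
    | zero => intro x y; simp [cubeAvg, signSum]
    | succ m ih =>
      intro x y
      have h1 : ∀ b ε, signSum x (Fin.cons b ε) =
          (if b then x 0 else -x 0) + signSum (fun i => x i.succ) ε := by
        intro b ε; simp [signSum, Fin.sum_univ_succ]
      rw [cubeAvg_succ]
      simp only [h1, ← add_assoc]
      rw [ih, ih, Fin.sum_univ_succ]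
      have := parallelogram_law_with_norm ℂ y (x 0)
      simp only [if_true, Bool.false_eq_true, if_false, ← sub_eq_add_neg]
      nlinarith
  refine Real.le_sqrt_of_sq_le ((cubeAvg_sq_le _).trans ?_)
  simpa using (key x 0).le

/-- Bounded functions, continuous on the closed strip and holomorphic on the open strip. -/
structure Adm (φ : ℂ → ℂ) : Prop where
  cont : ContinuousOn φ Strip
  diff : DifferentiableOn ℂ φ OStrip
  bdd : ∃ B : ℝ, ∀ z ∈ Strip, ‖φ z‖ ≤ B

namespace Adm

lemma const (c : ℂ) : Adm fun _ => c :=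
  ⟨continuousOn_const, differentiableOn_const c, ‖c‖, fun _ _ => le_rfl⟩

lemma add {φ ψ : ℂ → ℂ} (hφ : Adm φ) (hψ : Adm ψ) : Adm fun z => φ z + ψ z := by
  obtain ⟨B, hB⟩ := hφ.bdd
  obtain ⟨B', hB'⟩ := hψ.bdd
  exact ⟨hφ.cont.add hψ.cont, hφ.diff.add hψ.diff, B + B', fun z hz =>
    (norm_add_le _ _).trans (add_le_add (hB z hz) (hB' z hz))⟩

lemma mul {φ ψ : ℂ → ℂ} (hφ : Adm φ) (hψ : Adm ψ) : Adm fun z => φ z * ψ z := by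
  obtain ⟨B, hB⟩ := hφ.bdd
  obtain ⟨B', hB'⟩ := hψ.bdd
  refine ⟨hφ.cont.mul hψ.cont, hφ.diff.mul hψ.diff, B * B', fun z hz => ?_⟩
  rw [norm_mul]
  exact mul_le_mul (hB z hz) (hB' z hz) (norm_nonneg _) ((norm_nonneg _).trans (hB z hz))

lemma inv {φ : ℂ → ℂ} (hφ : Adm φ) {η : ℝ} (hη : 0 < η) (h : ∀ z ∈ Strip, η ≤ ‖φ z‖) :
    Adm fun z => (φ z)⁻¹ := by
  have hne : ∀ z ∈ Strip, φ z ≠ 0 := fun z hz h0 => by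
    have := h z hz; rw [h0, norm_zero] at this; linarith
  refine ⟨hφ.cont.inv₀ hne, hφ.diff.inv fun z hz => hne z ⟨hz.1.le, hz.2.le⟩, η⁻¹, fun z hz => ?_⟩
  rw [norm_inv]
  exact inv_anti₀ hη (h z hz)

lemma of_exp {φ : ℂ → ℂ} (hc : ContinuousOn φ Strip) (hd : DifferentiableOn ℂ φ OStrip) {B : ℝ}
    (hB : ∀ z ∈ Strip, (φ z).re ≤ B) : Adm fun z => Complex.exp (φ z) :=
  ⟨hc.cexp, hd.cexp, Real.exp B, fun z hz => by
    rw [Complex.norm_exp]; exact Real.exp_le_exp.2 (hB z hz)⟩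

lemma exp_affine (a b : ℝ) : Adm fun z => Complex.exp (a + b * z) := by
  refine of_exp (by fun_prop) (by fun_prop) (B := |a| + |b|) fun z hz => ?_
  have h1 : |b * z.re| ≤ |b| := by
    rw [abs_mul, abs_of_nonneg hz.1]
    exact mul_le_of_le_one_right (abs_nonneg _) hz.2
  have h2 := (abs_le.1 h1).2
  have h3 := le_abs_self a
  simp
  linarith

end Adm

lemma theta_mem_strip {θ : ℝ} (hθ : 0 < θ) (hθ1 : θ < 1) : (θ : ℂ) ∈ Strip :=
  ⟨by simpa using hθ.le, by simpa using hθ1.le⟩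

lemma left_mem_strip (t : ℝ) : Complex.I * t ∈ Strip := by constructor <;> simp

lemma right_mem_strip (t : ℝ) : 1 + Complex.I * t ∈ Strip := by constructor <;> simp

/-- Finite sums `z ↦ ∑ φᵢ(z) • vᵢ` with admissible coefficients. -/
def FinType {D : Type*} [AddCommGroup D] [Module ℂ D] (f : ℂ → D) : Prop :=
  ∃ (ι : Type) (_ : Fintype ι) (φ : ι → ℂ → ℂ) (v : ι → D),
    (∀ i, Adm (φ i)) ∧ ∀ z, f z = ∑ i, φ i z • v i

namespace FinType
variable {D D' : Type*} [AddCommGroup D] [Module ℂ D] [AddCommGroup D'] [Module ℂ D']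

lemma smul_const {φ : ℂ → ℂ} (h : Adm φ) (v : D) : FinType fun z => φ z • v :=
  ⟨Unit, inferInstance, fun _ => φ, fun _ => v, fun _ => h, fun z => by simp⟩

lemma zero : FinType fun _ => (0 : D) :=
  ⟨Empty, inferInstance, nofun, nofun, nofun, fun z => by simp⟩

lemma add {f g : ℂ → D} (hf : FinType f) (hg : FinType g) : FinType fun z => f z + g z := by
  obtain ⟨ι, _, φ, v, h, e⟩ := hf
  obtain ⟨κ, _, ψ, w, h', e'⟩ := hg
  refine ⟨ι ⊕ κ, inferInstance, Sum.elim φ ψ, Sum.elim v w, ?_, fun z => ?_⟩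
  · rintro (i | i)
    exacts [h i, h' i]
  · simp [e, e']

lemma sum {α : Type*} (s : Finset α) {f : α → ℂ → D} (hf : ∀ a, FinType (f a)) :
    FinType fun z => ∑ a ∈ s, f a z := by
  classical
  induction s using Finset.induction_on with
  | empty => simpa using zero
  | insert a s ha ih => simpa [Finset.sum_insert ha] using (hf a).add ih

lemma smul {f : ℂ → D} (hf : FinType f) {ψ : ℂ → ℂ} (hψ : Adm ψ) :
    FinType fun z => ψ z • f z := by
  obtain ⟨ι, _, φ, v, h, e⟩ := hf
  exact ⟨ι, inferInstance, fun i z => ψ z * φ i z, v, fun i => hψ.mul (h i),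
    fun z => by simp [e, Finset.smul_sum, mul_smul]⟩

lemma map {f : ℂ → D} (hf : FinType f) (L : D →ₗ[ℂ] D') : FinType fun z => L (f z) := by
  obtain ⟨ι, _, φ, v, h, e⟩ := hf
  exact ⟨ι, inferInstance, φ, fun i => L (v i), h, fun z => by simp [e]⟩

end FinType

section NormedFinType
variable {D : Type*} [NormedAddCommGroup D] [NormedSpace ℂ D] {f : ℂ → D}

lemma FinType.continuousOn (hf : FinType f) : ContinuousOn f Strip := by
  obtain ⟨ι, _, φ, v, h, e⟩ := hf
  rw [show f = _ from funext e]
  exact continuousOn_finsetSum _ fun i _ => (h i).cont.smul continuousOn_const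

lemma FinType.differentiableOn (hf : FinType f) : DifferentiableOn ℂ f OStrip := by
  obtain ⟨ι, _, φ, v, h, e⟩ := hf
  rw [show f = _ from funext e]
  exact DifferentiableOn.fun_sum fun i _ => (h i).diff.smul_const _

lemma FinType.bdd (hf : FinType f) : ∃ B : ℝ, ∀ z ∈ Strip, ‖f z‖ ≤ B := by
  obtain ⟨ι, _, φ, v, h, e⟩ := hf
  choose B hB using fun i => (h i).bdd
  refine ⟨∑ i, B i * ‖v i‖, fun z hz => ?_⟩
  rw [e]
  refine (norm_sum_le _ _).trans (Finset.sum_le_sum fun i _ => ?_)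
  rw [norm_smul]
  exact mul_le_mul_of_nonneg_right (hB i z hz) (norm_nonneg _)

/-- The maximum principle on the strip. -/
lemma FinType.norm_le (hf : FinType f) {c : ℝ} (h0 : ∀ t : ℝ, ‖f (Complex.I * t)‖ ≤ c)
    (h1 : ∀ t : ℝ, ‖f (1 + Complex.I * t)‖ ≤ c) {z : ℂ} (hz : z ∈ Strip) : ‖f z‖ ≤ c := by
  have hc : 0 ≤ c := (norm_nonneg _).trans (h0 0)
  have hcl : closure (HadamardThreeLines.verticalStrip 0 1) = Strip := by
    rw [HadamardThreeLines.verticalStrip, Complex.closure_preimage_re, closure_Ioo (by norm_num)]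
    rfl
  have := HadamardThreeLines.norm_le_interp_of_mem_verticalClosedStrip' (f := f) (z := z)
    (a := c) (b := c) (l := 0) (u := 1) one_pos hz
    ⟨hf.differentiableOn, hcl ▸ hf.continuousOn⟩ ?_ ?_ ?_
  · refine this.trans ?_
    rcases hc.eq_or_lt with rfl | hc
    · rcases eq_or_ne z.re 0 with h | h <;> simp [h]
    · rw [← Real.rpow_add hc]; simp
  · obtain ⟨B, hB⟩ := hf.bdd
    exact ⟨B, by rintro _ ⟨w, hw, rfl⟩; exact hB w hw⟩
  · intro w hw
    have hw' : w.re = 0 := hw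
    convert h0 w.im
    apply Complex.ext <;> simp [hw']
  · intro w hw
    have hw' : w.re = 1 := hw
    convert h1 w.im
    apply Complex.ext <;> simp [hw']

end NormedFinType

lemma Adm.norm_le {φ : ℂ → ℂ} (hf : Adm φ) {c : ℝ} (h0 : ∀ t : ℝ, ‖φ (Complex.I * t)‖ ≤ c)
    (h1 : ∀ t : ℝ, ‖φ (1 + Complex.I * t)‖ ≤ c) {z : ℂ} (hz : z ∈ Strip) : ‖φ z‖ ≤ c := by
  have : FinType φ := by simpa using FinType.smul_const hf (1 : ℂ)
  exact this.norm_le h0 h1 hz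

/-- The minimum principle for real parts on the strip. -/
lemma Adm.le_re {φ : ℂ → ℂ} (hf : Adm φ) {c : ℝ} (h0 : ∀ t : ℝ, c ≤ (φ (Complex.I * t)).re)
    (h1 : ∀ t : ℝ, c ≤ (φ (1 + Complex.I * t)).re) {z : ℂ} (hz : z ∈ Strip) : c ≤ (φ z).re := by
  obtain ⟨B, hB⟩ := hf.bdd
  have hadm : Adm fun z => Complex.exp (-φ z) :=
    Adm.of_exp hf.cont.neg hf.diff.neg (B := B) fun z hz =>
      (Complex.re_le_norm _).trans (by simpa using hB z hz)
  have := hadm.norm_le (c := Real.exp (-c))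
    (fun t => by rw [Complex.norm_exp, Real.exp_le_exp]; simpa using h0 t)
    (fun t => by rw [Complex.norm_exp, Real.exp_le_exp]; simpa using h1 t) hz
  rw [Complex.norm_exp, Real.exp_le_exp] at this
  simpa using this

section Interp
variable {D : Type*} [AddCommGroup D] [Module ℂ D] {θ : ℝ} {N₀ N₁ : D → ℝ}

lemma interpN_set_bddBelow (hN₀ : ∀ x, 0 ≤ N₀ x) (x : D) :
    BddBelow {c : ℝ | ∃ (m : ℕ) (φ : Fin m → ℂ → ℂ) (v : Fin m → D),
    (∀ i, ContinuousOn (φ i) Strip) ∧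
    (∀ i, DifferentiableOn ℂ (φ i) OStrip) ∧
    (∀ i, ∃ B : ℝ, ∀ z ∈ Strip, ‖φ i z‖ ≤ B) ∧
    (∑ i, φ i (θ : ℂ) • v i) = x ∧
    (∀ t : ℝ, N₀ (∑ i, φ i (Complex.I * t) • v i) ≤ c) ∧
    (∀ t : ℝ, N₁ (∑ i, φ i (1 + Complex.I * t) • v i) ≤ c)} :=
  ⟨0, fun _ ⟨_, _, _, _, _, _, _, h, _⟩ => (hN₀ _).trans (h 0)⟩

lemma interpN_nonneg (hN₀ : ∀ x, 0 ≤ N₀ x) (x : D) : 0 ≤ interpN θ N₀ N₁ x :=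
  Real.sInf_nonneg fun _ ⟨_, _, _, _, _, _, _, h, _⟩ => (hN₀ _).trans (h 0)

lemma interpN_le (hN₀ : ∀ x, 0 ≤ N₀ x) {f : ℂ → D} (hf : FinType f) {c : ℝ}
    (h0 : ∀ t : ℝ, N₀ (f (Complex.I * t)) ≤ c) (h1 : ∀ t : ℝ, N₁ (f (1 + Complex.I * t)) ≤ c) :
    interpN θ N₀ N₁ (f θ) ≤ c := by
  obtain ⟨ι, _, φ, v, h, e⟩ := hf
  let σ := (Fintype.equivFin ι).symm
  have e' : ∀ z, f z = ∑ i, φ (σ i) z • v (σ i) := fun z => by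
    rw [e, ← σ.sum_comp]
  refine csInf_le (interpN_set_bddBelow hN₀ _) ⟨Fintype.card ι, fun i => φ (σ i), fun i => v (σ i),
    fun i => (h _).cont, fun i => (h _).diff, fun i => (h _).bdd, (e' _).symm, fun t => ?_,
    fun t => ?_⟩
  · rw [← e']; exact h0 t
  · rw [← e']; exact h1 t

lemma exists_of_interpN_lt {x : D} {c : ℝ} (hx : interpN θ N₀ N₁ x < c) :
    ∃ f : ℂ → D, FinType f ∧ f θ = x ∧ (∀ t : ℝ, N₀ (f (Complex.I * t)) ≤ c) ∧
      ∀ t : ℝ, N₁ (f (1 + Complex.I * t)) ≤ c := by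
  unfold interpN at hx
  obtain ⟨d, ⟨m, φ, v, hc, hd, hb, e, h0, h1⟩, hdc⟩ := exists_lt_of_csInf_lt
    (by exact ⟨max (N₀ x) (N₁ x), 1, fun _ _ => 1, fun _ => x, fun _ => continuousOn_const,
      fun _ => differentiableOn_const _, fun _ => ⟨1, by simp⟩, by simp, by simp, by simp⟩) hx
  exact ⟨fun z => ∑ i, φ i z • v i, ⟨Fin m, inferInstance, φ, v,
    fun i => ⟨hc i, hd i, hb i⟩, fun _ => rfl⟩, e, fun t => (h0 t).trans hdc.le,
    fun t => (h1 t).trans hdc.le⟩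

lemma interpN_le_max (hN₀ : ∀ x, 0 ≤ N₀ x) (x : D) :
    interpN θ N₀ N₁ x ≤ max (N₀ x) (N₁ x) := by
  refine interpN_le (f := fun _ => x) hN₀ ?_ (by simp) (by simp)
  simpa using FinType.smul_const (Adm.const 1) x

lemma interpN_add_le (h₀ : IsNormC N₀) (h₁ : IsNormC N₁) (x y : D) :
    interpN θ N₀ N₁ (x + y) ≤ interpN θ N₀ N₁ x + interpN θ N₀ N₁ y := by
  refine le_of_forall_pos_le_add fun ε hε => ?_
  obtain ⟨f, hf, rfl, f0, f1⟩ := exists_of_interpN_lt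
    (show interpN θ N₀ N₁ x < interpN θ N₀ N₁ x + ε / 2 by linarith)
  obtain ⟨g, hg, rfl, g0, g1⟩ := exists_of_interpN_lt
    (show interpN θ N₀ N₁ y < interpN θ N₀ N₁ y + ε / 2 by linarith)
  refine interpN_le (f := fun z => f z + g z) h₀.1 (hf.add hg) (fun t => ?_) (fun t => ?_)
  · exact (h₀.2.2.2 _ _).trans (by linarith [f0 t, g0 t])
  · exact (h₁.2.2.2 _ _).trans (by linarith [f1 t, g1 t])

lemma interpN_smul (h₀ : IsNormC N₀) (h₁ : IsNormC N₁) (c : ℂ) (x : D) :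
    interpN θ N₀ N₁ (c • x) = ‖c‖ * interpN θ N₀ N₁ x := by
  have key : ∀ (c : ℂ) (x : D), interpN θ N₀ N₁ (c • x) ≤ ‖c‖ * interpN θ N₀ N₁ x := by
    intro c x
    refine le_of_forall_pos_le_add fun ε hε => ?_
    have hc : 0 < ‖c‖ + 1 := by positivity
    obtain ⟨f, hf, rfl, f0, f1⟩ := exists_of_interpN_lt
      (show interpN θ N₀ N₁ x < interpN θ N₀ N₁ x + ε / (‖c‖ + 1) by
        have : 0 < ε / (‖c‖ + 1) := by positivity
        linarith)
    have hle : ‖c‖ * (interpN θ N₀ N₁ (f θ) + ε / (‖c‖ + 1)) ≤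
        ‖c‖ * interpN θ N₀ N₁ (f θ) + ε := by
      have : ‖c‖ * (ε / (‖c‖ + 1)) ≤ ε := by
        rw [mul_div_assoc', div_le_iff₀ hc]; nlinarith [norm_nonneg c]
      linarith
    refine interpN_le (f := fun z => c • f z) h₀.1 (hf.smul (Adm.const c)) (fun t => ?_)
      (fun t => ?_)
    · rw [h₀.2.2.1]
      exact (mul_le_mul_of_nonneg_left (f0 t) (norm_nonneg _)).trans hle
    · rw [h₁.2.2.1]
      exact (mul_le_mul_of_nonneg_left (f1 t) (norm_nonneg _)).trans hle
  refine le_antisymm (key c x) ?_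
  rcases eq_or_ne c 0 with rfl | hc
  · simpa using interpN_nonneg h₀.1 _
  · have := key c⁻¹ (c • x)
    rw [inv_smul_smul₀ hc, norm_inv] at this
    rwa [le_inv_mul_iff₀ (norm_pos_iff.2 hc)] at this

end Interp

lemma le_interpN {D : Type*} [NormedAddCommGroup D] [NormedSpace ℂ D] {θ : ℝ} (hθ : 0 < θ)
    (hθ1 : θ < 1) {N₀ N₁ : D → ℝ} {κ : ℝ} (hκ : 0 < κ) (h₀ : ∀ x, κ * ‖x‖ ≤ N₀ x)
    (h₁ : ∀ x, κ * ‖x‖ ≤ N₁ x) (x : D) : κ * ‖x‖ ≤ interpN θ N₀ N₁ x := by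
  refine le_of_forall_pos_le_add fun ε hε => ?_
  obtain ⟨f, hf, rfl, f0, f1⟩ := exists_of_interpN_lt
    (show interpN θ N₀ N₁ x < interpN θ N₀ N₁ x + ε by linarith)
  rw [mul_comm, ← le_div_iff₀ hκ]
  refine hf.norm_le (fun t => ?_) (fun t => ?_) (theta_mem_strip hθ hθ1)
  · rw [le_div_iff₀ hκ, mul_comm]; exact (h₀ _).trans (f0 t)
  · rw [le_div_iff₀ hκ, mul_comm]; exact (h₁ _).trans (f1 t)

/-- Real parts of polynomials are uniformly dense in the real continuous functions on the
unit circle. -/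
lemma exists_polynomial_re_near (u : C(Circle, ℝ)) {ε : ℝ} (hε : 0 < ε) :
    ∃ p : Polynomial ℂ, ∀ w : Circle, |(p.eval (w : ℂ)).re - u w| ≤ ε := by
  have : Fact (0 < 2 * Real.pi) := ⟨Real.two_pi_pos⟩
  let g : C(AddCircle (2 * Real.pi), ℂ) :=
    ⟨fun x => (u (AddCircle.toCircle x) : ℂ), by
      have := AddCircle.continuous_toCircle (T := 2 * Real.pi)
      fun_prop⟩
  have hg : g ∈ (Submodule.span ℂ (Set.range <| @fourier (2 * Real.pi))).topologicalClosure := by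
    rw [span_fourier_closure_eq_top]; trivial
  obtain ⟨h, hh, hgh⟩ := Metric.mem_closure_iff.1 hg ε hε
  have key : ∀ h ∈ Submodule.span ℂ (Set.range <| @fourier (2 * Real.pi)),
      ∃ p q : Polynomial ℂ, ∀ x, h x = p.eval (AddCircle.toCircle x : ℂ) +
        (starRingEnd ℂ) (q.eval (AddCircle.toCircle x : ℂ)) := by
    intro h hh
    have hpow : ∀ (k : ℕ) (x : AddCircle (2 * Real.pi)),
        fourier (k : ℤ) x = (AddCircle.toCircle x : ℂ) ^ k := by
      intro k x
      simp [fourier_apply, AddCircle.toCircle_nsmul]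
    induction hh using Submodule.span_induction with
    | mem h hh =>
      obtain ⟨k, rfl⟩ := hh
      obtain ⟨k, rfl | rfl⟩ := k.eq_nat_or_neg
      · exact ⟨Polynomial.X ^ k, 0, fun x => by rw [hpow]; simp⟩
      · exact ⟨0, Polynomial.X ^ k, fun x => by rw [fourier_neg, hpow]; simp⟩
    | zero => exact ⟨0, 0, by simp⟩
    | add h k _ _ ih ih' =>
      obtain ⟨p, q, e⟩ := ih
      obtain ⟨p', q', e'⟩ := ih'
      refine ⟨p + p', q + q', fun x => ?_⟩
      rw [ContinuousMap.add_apply, e, e']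
      simp only [Polynomial.eval_add, map_add]; ring
    | smul c h _ ih =>
      obtain ⟨p, q, e⟩ := ih
      refine ⟨Polynomial.C c * p, Polynomial.C ((starRingEnd ℂ) c) * q, fun x => ?_⟩
      rw [ContinuousMap.smul_apply, e]
      simp; ring
  obtain ⟨p, q, e⟩ := key h hh
  refine ⟨p + q, fun w => ?_⟩
  obtain ⟨x, rfl⟩ : ∃ x : AddCircle (2 * Real.pi), AddCircle.toCircle x = w := by
    refine ⟨((Complex.arg w : ℝ) : AddCircle (2 * Real.pi)), ?_⟩
    rw [AddCircle.toCircle_apply_mk, div_self Real.two_pi_pos.ne', one_mul, Circle.exp_arg]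
  have h1 : ((p + q).eval (AddCircle.toCircle x : ℂ)).re = (h x).re := by
    rw [e]; simp
  have h2 : u (AddCircle.toCircle x) = (g x).re := by simp [g]
  rw [h1, h2, ← Complex.sub_re]
  refine (Complex.abs_re_le_norm _).trans ?_
  rw [← dist_eq_norm, dist_comm]
  exact (ContinuousMap.dist_apply_le_dist x).trans hgh.le

lemma ofReal_add_I_ne_zero (s : ℝ) : (s : ℂ) + Complex.I ≠ 0 := fun h => by
  have := congrArg Complex.im h
  simp at this

/-- The Cayley transform from the real line to the unit circle. -/
def cayley (s : ℝ) : Circle := ⟨(s - Complex.I) / (s + Complex.I), by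
  have h : (s : ℂ) - Complex.I = (starRingEnd ℂ) (s + Complex.I) := by simp [sub_eq_add_neg]
  have h0 : ‖(s : ℂ) + Complex.I‖ ≠ 0 := norm_ne_zero_iff.2 (ofReal_add_I_ne_zero s)
  rw [Submonoid.unitSphere, Submonoid.mem_mk, Subsemigroup.mem_mk, mem_sphere_zero_iff_norm,
    norm_div, h, RCLike.norm_conj, div_self h0]⟩

lemma coe_cayley (s : ℝ) : (cayley s : ℂ) =
    ((s ^ 2 - 1) / (s ^ 2 + 1) : ℝ) + (-(2 * s) / (s ^ 2 + 1) : ℝ) * Complex.I := by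
  have h0 := ofReal_add_I_ne_zero s
  have h1 : (s : ℂ) ^ 2 + 1 ≠ 0 := by
    exact_mod_cast (show s ^ 2 + 1 ≠ 0 by positivity)
  change ((s : ℂ) - Complex.I) / (s + Complex.I) = _
  push_cast
  field_simp
  ring_nf
  simp only [Complex.I_sq]
  ring

/-- A continuous function on the line vanishing at infinity, transplanted to the circle. -/
lemma exists_circle_extension {v : ℝ → ℝ} (hv : Continuous v)
    (hv0 : Filter.Tendsto v (Filter.cocompact ℝ) (nhds 0)) :
    ∃ u : C(Circle, ℝ), ∀ s, u (cayley s) = v s := by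
  classical
  let q : Circle → ℝ := fun w => -(w : ℂ).im / (1 - (w : ℂ).re)
  have hsq : ∀ w : Circle, (w : ℂ).re ^ 2 + (w : ℂ).im ^ 2 = 1 := fun w => by
    have := Circle.normSq_coe w
    rw [Complex.normSq_apply] at this
    nlinarith
  have hre : ∀ w : Circle, w ≠ 1 → 0 < 1 - (w : ℂ).re := by
    intro w hw
    have h := hsq w
    have h1 : (w : ℂ).re ≤ 1 := by nlinarith [sq_nonneg (w : ℂ).im]
    rcases h1.lt_or_eq with h1 | h1
    · linarith
    · refine absurd (Circle.ext (Complex.ext ?_ ?_)) hw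
      · simpa using h1
      · rw [h1] at h; simpa using h
  have hq : Filter.Tendsto q (nhdsWithin 1 {1}ᶜ) (Filter.cocompact ℝ) := by
    rw [← Metric.cobounded_eq_cocompact, ← tendsto_norm_atTop_iff_cobounded]
    have hcont : Continuous fun w : Circle => (w : ℂ).re :=
      by fun_prop
    have h1 : Filter.Tendsto (fun w : Circle => 1 - (w : ℂ).re) (nhdsWithin 1 {1}ᶜ)
        (nhdsWithin 0 (Set.Ioi 0)) := by
      refine tendsto_nhdsWithin_iff.2 ⟨?_, ?_⟩
      · refine Filter.Tendsto.mono_left ?_ nhdsWithin_le_nhds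
        have := (continuous_const.sub hcont).tendsto (1 : Circle) (f := fun w : Circle =>
          (1 : ℝ) - (w : ℂ).re)
        simpa using this
      · filter_upwards [self_mem_nhdsWithin] with w hw using hre w hw
    have h2 : Filter.Tendsto (fun w : Circle => 1 + (w : ℂ).re) (nhdsWithin 1 {1}ᶜ)
        (nhds 2) := by
      refine Filter.Tendsto.mono_left ?_ nhdsWithin_le_nhds
      have := (continuous_const.add hcont).tendsto (1 : Circle) (f := fun w : Circle =>
          (1 : ℝ) + (w : ℂ).re)
      convert this using 2
      simp; norm_num
    have h3 := h2.pos_mul_atTop two_pos (tendsto_inv_nhdsGT_zero.comp h1)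
    refine (Real.tendsto_sqrt_atTop.comp h3).congr' ?_
    filter_upwards [self_mem_nhdsWithin] with w hw
    have h4 := hre w hw
    rw [Real.norm_eq_abs, ← Real.sqrt_sq_eq_abs]
    simp only [Function.comp_apply]
    congr 1
    simp only [q, div_pow, neg_sq]
    field_simp
    nlinarith [hsq w]
  refine ⟨⟨Function.update (fun w => v (q w)) 1 0, ?_⟩, fun s => ?_⟩
  · rw [continuous_iff_continuousAt]
    intro w
    rcases eq_or_ne w 1 with rfl | hw
    · exact continuousAt_update_same.2 (hv0.comp hq)
    · refine (continuousAt_update_of_ne hw).2 (hv.continuousAt.comp ?_)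
      have h1 : ContinuousAt (fun w : Circle => (w : ℂ)) w := by fun_prop
      exact (Complex.continuous_im.continuousAt.comp h1).neg.div
        (continuousAt_const.sub (Complex.continuous_re.continuousAt.comp h1)) (hre w hw).ne'
  · have hs : s ^ 2 + 1 ≠ 0 := by positivity
    have h1 : (cayley s : ℂ).re = (s ^ 2 - 1) / (s ^ 2 + 1) := by
      rw [coe_cayley, Complex.add_re, Complex.ofReal_re, Complex.re_ofReal_mul, Complex.I_re]
      ring
    have h2 : (cayley s : ℂ).im = -(2 * s) / (s ^ 2 + 1) := by
      rw [coe_cayley, Complex.add_im, Complex.ofReal_im, Complex.im_ofReal_mul, Complex.I_im]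
      ring
    have hne : cayley s ≠ 1 := fun h => by
      rw [h] at h1
      simp at h1
      field_simp at h1
      linarith
    simp only [ContinuousMap.coe_mk, Function.update_of_ne hne, q, h1, h2]
    congr 1
    field_simp
    ring

/-- Logarithmic change of variables from the half-lines to the line. -/
lemma log_transplant {α : ℝ → ℝ} (hα : Continuous α)
    (h0 : Filter.Tendsto α (Filter.cocompact ℝ) (nhds 0)) :
    Continuous (Function.update (fun s => α (-Real.log s / Real.pi)) 0 0) ∧
    Filter.Tendsto (Function.update (fun s => α (-Real.log s / Real.pi)) 0 0)
      (Filter.cocompact ℝ) (nhds 0) := by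
  rw [Metric.cobounded_eq_cocompact.symm] at *
  have hneg : Filter.Tendsto (fun x : ℝ => -x / Real.pi) Filter.atTop (Bornology.cobounded ℝ) :=
    ((Filter.tendsto_neg_atTop_atBot).atBot_div_const Real.pi_pos).mono_right
      (by rw [IsOrderBornology.cobounded_eq]; exact le_sup_left)
  have hpos : Filter.Tendsto (fun x : ℝ => -x / Real.pi) Filter.atBot (Bornology.cobounded ℝ) :=
    ((Filter.tendsto_neg_atBot_atTop).atTop_div_const Real.pi_pos).mono_right
      (by rw [IsOrderBornology.cobounded_eq]; exact le_sup_right)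
  constructor
  · rw [continuous_iff_continuousAt]
    intro s
    rcases eq_or_ne s 0 with rfl | hs
    · exact continuousAt_update_same.2 (h0.comp (hpos.comp Real.tendsto_log_nhdsNE_zero))
    · refine (continuousAt_update_of_ne hs).2 (hα.continuousAt.comp ?_)
      exact (Real.continuousAt_log hs).neg.div_const _
  · have h1 : Filter.Tendsto (fun s : ℝ => Real.log s) (Bornology.cobounded ℝ) Filter.atTop := by
      refine (Real.tendsto_log_atTop.comp tendsto_norm_cobounded_atTop).congr fun s => ?_
      simp [Real.norm_eq_abs, Real.log_abs]
    refine (h0.comp (hneg.comp h1)).congr' ?_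
    filter_upwards [tendsto_norm_cobounded_atTop.eventually_gt_atTop (0 : ℝ)] with s hs
    rw [Function.update_of_ne (norm_pos_iff.1 hs)]
    rfl

/-- The conformal map of the strip onto the disc. -/
def stripToDisc (z : ℂ) : ℂ :=
  (Complex.exp (Real.pi * Complex.I * z) - Complex.I) /
    (Complex.exp (Real.pi * Complex.I * z) + Complex.I)

lemma exp_im_nonneg {z : ℂ} (hz : z ∈ Strip) :
    0 ≤ (Complex.exp (Real.pi * Complex.I * z)).im := by
  rw [Complex.exp_im]
  refine mul_nonneg (Real.exp_pos _).le ?_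
  have : (Real.pi * Complex.I * z).im = Real.pi * z.re := by simp
  rw [this]
  exact Real.sin_nonneg_of_nonneg_of_le_pi (mul_nonneg Real.pi_pos.le hz.1)
    (mul_le_of_le_one_right Real.pi_pos.le hz.2)

lemma exp_add_I_ne_zero {z : ℂ} (hz : z ∈ Strip) :
    Complex.exp (Real.pi * Complex.I * z) + Complex.I ≠ 0 := fun h => by
  have := congrArg Complex.im h
  simp only [Complex.add_im, Complex.I_im, Complex.zero_im] at this
  linarith [exp_im_nonneg hz]

lemma norm_stripToDisc_le {z : ℂ} (hz : z ∈ Strip) : ‖stripToDisc z‖ ≤ 1 := by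
  rw [stripToDisc, norm_div, div_le_one (norm_pos_iff.2 (exp_add_I_ne_zero hz))]
  have h := exp_im_nonneg hz
  rw [← sq_le_sq₀ (norm_nonneg _) (norm_nonneg _), Complex.sq_norm, Complex.sq_norm,
    Complex.normSq_apply, Complex.normSq_apply]
  simp only [Complex.sub_re, Complex.sub_im, Complex.add_re, Complex.add_im, Complex.I_re,
    Complex.I_im]
  nlinarith

lemma adm_polynomial_comp (p : Polynomial ℂ) : Adm fun z => p.eval (stripToDisc z) := by
  have hc : ContinuousOn stripToDisc Strip :=
    ContinuousOn.div (by fun_prop) (by fun_prop) fun z hz => exp_add_I_ne_zero hz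
  have hd : DifferentiableOn ℂ stripToDisc OStrip :=
    DifferentiableOn.div (by fun_prop) (by fun_prop)
      fun z hz => exp_add_I_ne_zero ⟨hz.1.le, hz.2.le⟩
  obtain ⟨B, hB⟩ := (isCompact_closedBall (0 : ℂ) 1).exists_bound_of_continuousOn
    p.continuous.continuousOn
  exact ⟨p.continuous.comp_continuousOn hc, p.differentiable.comp_differentiableOn hd, B,
    fun z hz => hB _ (by simpa using norm_stripToDisc_le hz)⟩

lemma stripToDisc_left (t : ℝ) :
    stripToDisc (Complex.I * t) = cayley (Real.exp (-(Real.pi * t))) := by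
  change _ = ((Real.exp (-(Real.pi * t)) : ℝ) - Complex.I) /
    ((Real.exp (-(Real.pi * t)) : ℝ) + Complex.I)
  have : (Real.pi * Complex.I * (Complex.I * t) : ℂ) = ((-(Real.pi * t) : ℝ) : ℂ) := by
    push_cast
    linear_combination (Real.pi * t : ℂ) * Complex.I_mul_I
  rw [stripToDisc, this, Complex.ofReal_exp]

lemma stripToDisc_right (t : ℝ) :
    stripToDisc (1 + Complex.I * t) = cayley (-Real.exp (-(Real.pi * t))) := by
  change _ = ((-Real.exp (-(Real.pi * t)) : ℝ) - Complex.I) /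
    ((-Real.exp (-(Real.pi * t)) : ℝ) + Complex.I)
  have : (Real.pi * Complex.I * (1 + Complex.I * t) : ℂ) =
      ((-(Real.pi * t) : ℝ) : ℂ) + Real.pi * Complex.I := by
    push_cast
    linear_combination (Real.pi * t : ℂ) * Complex.I_mul_I
  rw [stripToDisc, this, Complex.exp_add, Complex.exp_pi_mul_I, mul_neg_one,
    ← Complex.ofReal_exp, ← Complex.ofReal_neg]

/-- Approximate solvability of the Dirichlet problem on the strip for boundary data vanishing
at infinity. -/
lemma exists_adm_re_near {α β : ℝ → ℝ} (hα : Continuous α) (hβ : Continuous β)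
    (hα0 : Filter.Tendsto α (Filter.cocompact ℝ) (nhds 0))
    (hβ0 : Filter.Tendsto β (Filter.cocompact ℝ) (nhds 0)) {ε : ℝ} (hε : 0 < ε) :
    ∃ G : ℂ → ℂ, Adm G ∧ (∀ t : ℝ, |(G (Complex.I * t)).re - α t| ≤ ε) ∧
      ∀ t : ℝ, |(G (1 + Complex.I * t)).re - β t| ≤ ε := by
  obtain ⟨ha, ha0⟩ := log_transplant hα hα0
  obtain ⟨hb, hb0⟩ := log_transplant hβ hβ0
  set a := Function.update (fun s => α (-Real.log s / Real.pi)) 0 0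
  set b := Function.update (fun s => β (-Real.log s / Real.pi)) 0 0
  obtain ⟨u, hu⟩ := exists_circle_extension (v := fun s => if 0 ≤ s then a s else b s)
    (Continuous.if_le ha hb continuous_const continuous_id fun s hs => by
      simp [a, b, ← hs])
    (ha0.if' hb0)
  obtain ⟨p, hp⟩ := exists_polynomial_re_near u hε
  have hpi := Real.pi_pos.ne'
  refine ⟨_, adm_polynomial_comp p, fun t => ?_, fun t => ?_⟩
  · have h := hp (cayley (Real.exp (-(Real.pi * t))))
    rw [hu, if_pos (Real.exp_pos _).le] at h
    simp only [a, Function.update_of_ne (Real.exp_pos _).ne', Real.log_exp, neg_neg,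
      mul_div_cancel_left₀ t hpi] at h
    rwa [stripToDisc_left]
  · have h := hp (cayley (-Real.exp (-(Real.pi * t))))
    rw [hu, if_neg (by simpa using Real.exp_pos _)] at h
    simp only [b, Function.update_of_ne (neg_ne_zero.2 (Real.exp_pos _).ne'), Real.log_neg_eq_log,
      Real.log_exp, neg_neg, mul_div_cancel_left₀ t hpi] at h
    rwa [stripToDisc_right]

section NormEquivalence
variable {V : Type*} [NormedAddCommGroup V] [NormedSpace ℂ V] {N : V → ℝ}

lemma IsNormC.map_zero {V : Type*} [AddCommGroup V] [Module ℂ V] {N : V → ℝ}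
    (h : IsNormC N) : N 0 = 0 := by
  simpa using h.2.2.1 0 0

lemma IsNormC.map_sum_le {V : Type*} [AddCommGroup V] [Module ℂ V] {N : V → ℝ}
    (h : IsNormC N) {ι : Type*} (s : Finset ι) (x : ι → V) :
    N (∑ i ∈ s, x i) ≤ ∑ i ∈ s, N (x i) :=
  Finset.le_sum_of_subadditive N h.map_zero.le h.2.2.2 s x

variable [FiniteDimensional ℂ V]

lemma IsNormC.exists_le_norm (h : IsNormC N) : ∃ c : ℝ, 0 < c ∧ ∀ x, N x ≤ c * ‖x‖ := by
  let b := Module.finBasis ℂ V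
  let L : ∀ _, V →L[ℂ] ℂ := fun i => LinearMap.toContinuousLinearMap (b.coord i)
  refine ⟨∑ i, ‖L i‖ * N (b i) + 1,
    add_pos_of_nonneg_of_pos (Finset.sum_nonneg fun i _ => mul_nonneg (norm_nonneg _) (h.1 _))
      one_pos, fun x => ?_⟩
  calc N x = N (∑ i, L i x • b i) := by
        congr 1; exact (b.sum_repr x).symm
    _ ≤ ∑ i, N (L i x • b i) := h.map_sum_le _ _
    _ ≤ ∑ i, ‖L i‖ * N (b i) * ‖x‖ := Finset.sum_le_sum fun i _ => by
        rw [h.2.2.1, mul_right_comm]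
        exact mul_le_mul_of_nonneg_right ((L i).le_opNorm x) (h.1 _)
    _ ≤ _ := by
        rw [← Finset.sum_mul]
        exact mul_le_mul_of_nonneg_right (by linarith) (norm_nonneg _)

lemma IsNormC.continuous (h : IsNormC N) : Continuous N := by
  obtain ⟨c, hc, hN⟩ := h.exists_le_norm
  refine (LipschitzWith.of_le_add_mul c.toNNReal fun x y => ?_).continuous
  rw [Real.coe_toNNReal _ hc.le, dist_eq_norm]
  have := h.2.2.2 y (x - y)
  rw [add_sub_cancel] at this
  exact this.trans (add_le_add_right (hN _) _)

lemma IsNormC.exists_norm_le (h : IsNormC N) : ∃ κ : ℝ, 0 < κ ∧ ∀ x, κ * ‖x‖ ≤ N x := by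
  have : ProperSpace V := FiniteDimensional.proper ℂ V
  rcases (Metric.sphere (0 : V) 1).eq_empty_or_nonempty with he | hne
  · refine ⟨1, one_pos, fun x => ?_⟩
    rcases eq_or_ne x 0 with rfl | hx
    · simp [h.map_zero]
    · have : ((‖x‖ : ℂ)⁻¹ • x) ∈ Metric.sphere (0 : V) 1 := by
        simp [norm_smul, norm_ne_zero_iff.2 hx]
      rw [he] at this
      exact this.elim
  · obtain ⟨x₀, hx₀, hmin⟩ := (isCompact_sphere (0 : V) 1).exists_isMinOn hne
      h.continuous.continuousOn
    have hx₀n : x₀ ≠ 0 := by rintro rfl; simp at hx₀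
    refine ⟨N x₀, (h.1 _).lt_of_ne fun e => hx₀n (h.2.1 _ e.symm), fun x => ?_⟩
    rcases eq_or_ne x 0 with rfl | hx
    · simp [h.map_zero]
    · have hpos := norm_pos_iff.2 hx
      have : N x₀ ≤ N ((‖x‖ : ℂ)⁻¹ • x) := hmin (by simp [norm_smul, hpos.ne'])
      rw [h.2.2.1, norm_inv, Complex.norm_real, norm_norm, inv_mul_eq_div] at this
      exact (le_div_iff₀ hpos).1 this

end NormEquivalence

lemma continuous_left_line {V : Type*} [NormedAddCommGroup V] [NormedSpace ℂ V]
    {f : ℂ → V} (hf : FinType f) :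
    Continuous fun t : ℝ => f (Complex.I * t) :=
  hf.continuousOn.comp_continuous (by fun_prop) left_mem_strip

lemma continuous_right_line {V : Type*} [NormedAddCommGroup V] [NormedSpace ℂ V]
    {f : ℂ → V} (hf : FinType f) :
    Continuous fun t : ℝ => f (1 + Complex.I * t) :=
  hf.continuousOn.comp_continuous (by fun_prop) right_mem_strip

section SumInterpolation
variable {V : Type*} [NormedAddCommGroup V] [NormedSpace ℂ V] [FiniteDimensional ℂ V]
  {N₀ N₁ : V → ℝ} {θ : ℝ} {n : ℕ}

/-- Interpolation of a finite `ℓ₁`-sum, for data decaying on the boundary of the strip. -/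
lemma sum_interpN_le_of_tendsto (hθ : 0 < θ) (hθ1 : θ < 1) (h₀ : IsNormC N₀) (h₁ : IsNormC N₁)
    {f : Fin n → ℂ → V} (hf : ∀ i, FinType (f i)) {c : ℝ}
    (hc₀ : ∀ t : ℝ, ∑ i, N₀ (f i (Complex.I * t)) ≤ c)
    (hc₁ : ∀ t : ℝ, ∑ i, N₁ (f i (1 + Complex.I * t)) ≤ c)
    (ht₀ : ∀ i, Filter.Tendsto (fun t : ℝ => N₀ (f i (Complex.I * t))) (Filter.cocompact ℝ)
      (nhds 0))
    (ht₁ : ∀ i, Filter.Tendsto (fun t : ℝ => N₁ (f i (1 + Complex.I * t))) (Filter.cocompact ℝ)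
      (nhds 0)) :
    ∑ i, interpN θ N₀ N₁ (f i θ) ≤ c := by
  refine le_of_forall_pos_le_add fun η hη => ?_
  obtain ⟨ε, hε, hεη⟩ : ∃ ε : ℝ, 0 < ε ∧ n * (3 * ε) ≤ η :=
    ⟨η / (3 * (n + 1)), by positivity, by
      rw [mul_div_assoc', mul_div_assoc', div_le_iff₀ (by positivity)]
      nlinarith⟩
  choose G hG hG₀ hG₁ using fun i => exists_adm_re_near
    (h₀.continuous.comp (continuous_left_line (hf i)))
    (h₁.continuous.comp (continuous_right_line (hf i))) (ht₀ i) (ht₁ i) hε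
  let H : Fin n → ℂ → ℂ := fun i z => G i z + (2 * ε - (G i θ).im * Complex.I)
  have hH : ∀ i, Adm (H i) := fun i => (hG i).add (Adm.const _)
  have hHre : ∀ i z, (H i z).re = (G i z).re + 2 * ε := fun i z => by simp [H]
  have hl₀ : ∀ i (t : ℝ), N₀ (f i (Complex.I * t)) + ε ≤ (H i (Complex.I * t)).re ∧
      (H i (Complex.I * t)).re ≤ N₀ (f i (Complex.I * t)) + 3 * ε := fun i t => by
    have := abs_le.1 (hG₀ i t)
    simp only [Function.comp_apply] at this
    rw [hHre]
    constructor <;> linarith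
  have hl₁ : ∀ i (t : ℝ), N₁ (f i (1 + Complex.I * t)) + ε ≤ (H i (1 + Complex.I * t)).re ∧
      (H i (1 + Complex.I * t)).re ≤ N₁ (f i (1 + Complex.I * t)) + 3 * ε := fun i t => by
    have := abs_le.1 (hG₁ i t)
    simp only [Function.comp_apply] at this
    rw [hHre]
    constructor <;> linarith
  have hHε : ∀ i, ∀ z ∈ Strip, ε ≤ (H i z).re := fun i z hz => (hH i).le_re
    (fun t => by linarith [hl₀ i t, h₀.1 (f i (Complex.I * t))])
    (fun t => by linarith [hl₁ i t, h₁.1 (f i (1 + Complex.I * t))]) hz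
  have hθs := theta_mem_strip hθ hθ1
  have hreal : ∀ i, H i θ = ((H i θ).re : ℝ) := fun i => by
    apply Complex.ext <;> simp [H]
  have hstep : ∀ i, interpN θ N₀ N₁ (f i θ) ≤ (H i θ).re := fun i => by
    have hp := hε.trans_le (hHε i θ hθs)
    have hft : FinType fun z => (((H i θ).re : ℂ) * (H i z)⁻¹) • f i z :=
      (hf i).smul ((Adm.const _).mul ((hH i).inv hε fun z hz =>
        (hHε i z hz).trans (Complex.re_le_norm _)))
    have hb : ∀ {N : V → ℝ} (_ : IsNormC N) (z : ℂ), N (f i z) + ε ≤ (H i z).re →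
        N ((((H i θ).re : ℂ) * (H i z)⁻¹) • f i z) ≤ (H i θ).re := fun hN z hz => by
      have h1 := hz.trans (Complex.re_le_norm _)
      have h2 := hN.1 (f i z)
      rw [hN.2.2.1, norm_mul, Complex.norm_real, Real.norm_of_nonneg hp.le, norm_inv, mul_assoc,
        inv_mul_eq_div]
      exact mul_le_of_le_one_right hp.le (div_le_one_of_le₀ (by linarith) (norm_nonneg _))
    have := interpN_le (θ := θ) h₀.1 hft (fun t => hb h₀ _ (hl₀ i t).1)
      (fun t => hb h₁ _ (hl₁ i t).1)
    have hne : ((H i θ).re : ℂ) ≠ 0 := by exact_mod_cast hp.ne'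
    rwa [hreal i, Complex.ofReal_re, mul_inv_cancel₀ hne, one_smul] at this
  have hneg : Adm fun z => -∑ i, H i z := by
    have h1 : FinType fun z => ∑ i, H i z := FinType.sum _ fun i => by
      simpa using FinType.smul_const (hH i) (1 : ℂ)
    obtain ⟨B, hB⟩ := h1.bdd
    exact ⟨h1.continuousOn.neg, h1.differentiableOn.neg, B, fun z hz => by
      simpa using hB z hz⟩
  have := hneg.le_re (c := -(c + n * (3 * ε))) (fun t => ?_) (fun t => ?_) hθs
  · simp only [Complex.neg_re, Complex.re_sum] at this
    linarith [Finset.sum_le_sum fun i (_ : i ∈ Finset.univ) => hstep i]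
  · simp only [Complex.neg_re, Complex.re_sum]
    have h2 := Finset.sum_le_sum fun i (_ : i ∈ Finset.univ) => (hl₀ i t).2
    rw [Finset.sum_add_distrib] at h2
    simp only [Finset.sum_const, Finset.card_univ, Fintype.card_fin, nsmul_eq_mul] at h2
    linarith [hc₀ t]
  · simp only [Complex.neg_re, Complex.re_sum]
    have h2 := Finset.sum_le_sum fun i (_ : i ∈ Finset.univ) => (hl₁ i t).2
    rw [Finset.sum_add_distrib] at h2
    simp only [Finset.sum_const, Finset.card_univ, Fintype.card_fin, nsmul_eq_mul] at h2
    linarith [hc₁ t]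

/-- Interpolation of a finite `ℓ₁`-sum. -/
lemma sum_interpN_le (hθ : 0 < θ) (hθ1 : θ < 1) (h₀ : IsNormC N₀) (h₁ : IsNormC N₁)
    {f : Fin n → ℂ → V} (hf : ∀ i, FinType (f i)) {c : ℝ}
    (hc₀ : ∀ t : ℝ, ∑ i, N₀ (f i (Complex.I * t)) ≤ c)
    (hc₁ : ∀ t : ℝ, ∑ i, N₁ (f i (1 + Complex.I * t)) ≤ c) :
    ∑ i, interpN θ N₀ N₁ (f i θ) ≤ c := by
  have hc : 0 ≤ c := (Finset.sum_nonneg fun i _ => h₀.1 _).trans (hc₀ 0)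
  have key : ∀ δ : ℝ, 0 < δ → ∑ i, interpN θ N₀ N₁ (f i θ) ≤ Real.exp δ * c := by
    intro δ hδ
    let e : ℂ → ℂ := fun z => Complex.exp (δ * (z ^ 2 - θ ^ 2))
    have he : Adm e := Adm.of_exp (B := δ) (by fun_prop) (by fun_prop) fun z hz => by
      have : (δ * (z ^ 2 - θ ^ 2) : ℂ).re = δ * (z.re ^ 2 - z.im ^ 2 - θ ^ 2) := by
        simp [sq]
      rw [this]
      have h1 : z.re ^ 2 ≤ 1 := pow_le_one₀ hz.1 hz.2
      nlinarith [sq_nonneg z.im, sq_nonneg θ]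
    have heθ : e θ = 1 := by simp [e]
    have hn₀ : ∀ t : ℝ, ‖e (Complex.I * t)‖ ≤ Real.exp δ * Real.exp (-δ * ‖t‖ ^ 2) := fun t => by
      have : (δ * ((Complex.I * t) ^ 2 - θ ^ 2) : ℂ).re = δ * (- t ^ 2 - θ ^ 2) := by
        simp [sq]
      rw [Complex.norm_exp, this, ← Real.exp_add, Real.norm_eq_abs, sq_abs]
      exact Real.exp_le_exp.2 (by nlinarith [sq_nonneg θ])
    have hn₁ : ∀ t : ℝ, ‖e (1 + Complex.I * t)‖ ≤ Real.exp δ * Real.exp (-δ * ‖t‖ ^ 2) :=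
        fun t => by
      have : (δ * ((1 + Complex.I * t) ^ 2 - θ ^ 2) : ℂ).re = δ * (1 - t ^ 2 - θ ^ 2) := by
        simp [sq]
      rw [Complex.norm_exp, this, ← Real.exp_add, Real.norm_eq_abs, sq_abs]
      exact Real.exp_le_exp.2 (by nlinarith [sq_nonneg θ])
    have hle : ∀ t : ℝ, Real.exp δ * Real.exp (-δ * ‖t‖ ^ 2) ≤ Real.exp δ := fun t =>
      mul_le_of_le_one_right (Real.exp_pos _).le (Real.exp_le_one_iff.2 (by
        nlinarith [sq_nonneg ‖t‖]))
    have hlim : Filter.Tendsto (fun t : ℝ => Real.exp δ * Real.exp (-δ * ‖t‖ ^ 2) * c)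
        (Filter.cocompact ℝ) (nhds 0) := by
      have h1 : Filter.Tendsto (fun t : ℝ => -δ * ‖t‖ ^ 2) (Filter.cocompact ℝ) Filter.atBot :=
        Filter.Tendsto.const_mul_atTop_of_neg (by linarith)
          ((Filter.tendsto_pow_atTop two_ne_zero).comp tendsto_norm_cocompact_atTop)
      simpa using ((Real.tendsto_exp_atBot.comp h1).const_mul (Real.exp δ)).mul_const c
    have := sum_interpN_le_of_tendsto (c := Real.exp δ * c) hθ hθ1 h₀ h₁
      (f := fun i z => e z • f i z) (fun i => (hf i).smul he) (fun t => ?_) (fun t => ?_)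
      (fun i => ?_) (fun i => ?_)
    · simpa only [heθ, one_smul] using this
    · simp only [h₀.2.2.1]
      rw [← Finset.mul_sum]
      exact mul_le_mul ((hn₀ t).trans (hle t)) (hc₀ t) (Finset.sum_nonneg fun i _ => h₀.1 _)
        (Real.exp_pos _).le
    · simp only [h₁.2.2.1]
      rw [← Finset.mul_sum]
      exact mul_le_mul ((hn₁ t).trans (hle t)) (hc₁ t) (Finset.sum_nonneg fun i _ => h₁.1 _)
        (Real.exp_pos _).le
    · refine squeeze_zero (fun t => h₀.1 _) (fun t => ?_) hlim
      rw [h₀.2.2.1]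
      exact mul_le_mul (hn₀ t) ((Finset.single_le_sum (fun j _ => h₀.1 (f j (Complex.I * t)))
        (Finset.mem_univ i)).trans (hc₀ t)) (h₀.1 _) (by positivity)
    · refine squeeze_zero (fun t => h₁.1 _) (fun t => ?_) hlim
      rw [h₁.2.2.1]
      exact mul_le_mul (hn₁ t) ((Finset.single_le_sum
        (fun j _ => h₁.1 (f j (1 + Complex.I * t)))
        (Finset.mem_univ i)).trans (hc₁ t)) (h₁.1 _) (by positivity)
  have hlim : Filter.Tendsto (fun δ : ℝ => Real.exp δ * c) (nhdsWithin 0 (Set.Ioi 0))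
      (nhds c) := by
    refine Filter.Tendsto.mono_left ?_ nhdsWithin_le_nhds
    have : Continuous fun δ : ℝ => Real.exp δ * c := by fun_prop
    simpa using this.tendsto 0
  refine ge_of_tendsto hlim ?_
  filter_upwards [self_mem_nhdsWithin] with δ hδ using key δ hδ

end SumInterpolation

section GeometricWeight

/-- The analytic family `a^{1-z} b^z`, read as `0` unless both `a` and `b` are positive. -/
def geomWeight (a b : ℝ) (z : ℂ) : ℂ :=
  if 0 < a ∧ 0 < b then
    Complex.exp ((Real.log a : ℝ) + ((Real.log b - Real.log a : ℝ) : ℂ) * z) else 0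

lemma adm_geomWeight (a b : ℝ) : Adm (geomWeight a b) := by
  unfold geomWeight
  split_ifs
  · exact Adm.exp_affine _ _
  · exact Adm.const 0

lemma norm_geomWeight_left {a : ℝ} (b : ℝ) (ha : 0 ≤ a) (t : ℝ) :
    ‖geomWeight a b (Complex.I * t)‖ ≤ a := by
  unfold geomWeight
  split_ifs with h
  · rw [Complex.norm_exp]
    simp [Real.exp_log h.1]
  · simpa using ha

lemma norm_geomWeight_right (a : ℝ) {b : ℝ} (hb : 0 ≤ b) (t : ℝ) :
    ‖geomWeight a b (1 + Complex.I * t)‖ ≤ b := by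
  unfold geomWeight
  split_ifs with h
  · rw [Complex.norm_exp]
    simp [Real.exp_log h.2]
  · simpa using hb

lemma geomWeight_theta {θ : ℝ} (hθ : 0 < θ) (hθ1 : θ < 1) {a b : ℝ} (ha : 0 ≤ a) (hb : 0 ≤ b) :
    geomWeight a b θ = ((a ^ (1 - θ) * b ^ θ : ℝ) : ℂ) := by
  unfold geomWeight
  split_ifs with h
  · rw [Real.rpow_def_of_pos h.1, Real.rpow_def_of_pos h.2, ← Real.exp_add, Complex.ofReal_exp]
    congr 1
    push_cast
    ring
  · rcases ha.eq_or_lt with rfl | ha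
    · simp [Real.zero_rpow (sub_pos.2 hθ1).ne']
    · obtain rfl : 0 = b := hb.eq_of_not_lt fun hb => h ⟨ha, hb⟩
      simp [Real.zero_rpow hθ.ne']

end GeometricWeight

section Pairing
variable {V : Type*} [NormedAddCommGroup V] [NormedSpace ℂ V] [FiniteDimensional ℂ V]
  {NE₀ NE₁ : V → ℝ} {θ : ℝ} {n : ℕ} {NX₀ NX₁ : (Fin n → ℝ) → ℝ}

lemma sum_interpN_mul_le (hθ : 0 < θ) (hθ1 : θ < 1)
    (h₀ : IsNormC NE₀) (h₁ : IsNormC NE₁) {M₀ M₁ : ℝ} (hM₀ : 0 ≤ M₀) (hM₁ : 0 ≤ M₁)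
    {y u : Fin n → ℝ} (hy0 : ∀ i, 0 ≤ y i) (hu0 : ∀ i, 0 ≤ u i)
    (hy : ∀ g : Fin n → ℝ, (∀ i, 0 ≤ g i) → ∑ i, y i * g i ≤ M₀ * NX₀ g)
    (hu : ∀ g : Fin n → ℝ, (∀ i, 0 ≤ g i) → ∑ i, u i * g i ≤ M₁ * NX₁ g) (x : Fin n → V) :
    ∑ i, interpN θ NE₀ NE₁ (x i) * (y i ^ (1 - θ) * u i ^ θ) ≤
      M₀ ^ (1 - θ) * M₁ ^ θ * interpN θ (vecLatNorm NX₀ NE₀) (vecLatNorm NX₁ NE₁) x := by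
  have hθ' := sub_pos.2 hθ1
  have hzero : ∀ {w : Fin n → ℝ} {M : ℝ} {N : (Fin n → ℝ) → ℝ}, M = 0 → (∀ i, 0 ≤ w i) →
      (∀ g : Fin n → ℝ, (∀ i, 0 ≤ g i) → ∑ i, w i * g i ≤ M * N g) → ∀ i, w i = 0 := by
    rintro w M N rfl hw0 hw i
    have h1 := hw (fun _ => 1) fun _ => zero_le_one
    simp only [mul_one, zero_mul] at h1
    exact le_antisymm ((Finset.single_le_sum (fun j _ => hw0 j) (Finset.mem_univ i)).trans h1)
      (hw0 i)
  rcases hM₀.eq_or_lt with hM | hM₀'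
  · simp [hzero hM.symm hy0 hy, ← hM, Real.zero_rpow hθ'.ne']
  rcases hM₁.eq_or_lt with hM | hM₁'
  · simp [hzero hM.symm hu0 hu, ← hM, Real.zero_rpow hθ.ne']
  have hscale : ∀ i, y i ^ (1 - θ) * u i ^ θ =
      M₀ ^ (1 - θ) * M₁ ^ θ * ((y i / M₀) ^ (1 - θ) * (u i / M₁) ^ θ) := fun i => by
    rw [Real.div_rpow (hy0 i) hM₀, Real.div_rpow (hu0 i) hM₁]
    have := (Real.rpow_pos_of_pos hM₀' (1 - θ)).ne'
    have := (Real.rpow_pos_of_pos hM₁' θ).ne'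
    field_simp
  simp only [hscale, mul_left_comm _ (M₀ ^ (1 - θ) * M₁ ^ θ)]
  rw [← Finset.mul_sum]
  refine mul_le_mul_of_nonneg_left ?_ (by positivity)
  refine le_of_forall_pos_le_add fun ε hε => ?_
  obtain ⟨F, hF, rfl, F0, F1⟩ := exists_of_interpN_lt (lt_add_of_pos_right
    (interpN θ (vecLatNorm NX₀ NE₀) (vecLatNorm NX₁ NE₁) x) hε)
  set c := interpN θ (vecLatNorm NX₀ NE₀) (vecLatNorm NX₁ NE₁) (F θ) + ε
  have hy0' := fun i => div_nonneg (hy0 i) hM₀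
  have hu0' := fun i => div_nonneg (hu0 i) hM₁
  have := sum_interpN_le (c := c) hθ hθ1 h₀ h₁
    (f := fun i z => geomWeight (y i / M₀) (u i / M₁) z • F z i)
    (fun i => (hF.map (LinearMap.proj (R := ℂ) (φ := fun _ : Fin n => V) i)).smul
      (adm_geomWeight _ _)) (fun t => ?_) (fun t => ?_)
  · refine le_of_eq_of_le (Finset.sum_congr rfl fun i _ => ?_) this
    rw [interpN_smul h₀ h₁, geomWeight_theta hθ hθ1 (hy0' i) (hu0' i), Complex.norm_real,
      Real.norm_of_nonneg (mul_nonneg (Real.rpow_nonneg (hy0' i) _) (Real.rpow_nonneg (hu0' i) _)),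
      mul_comm]
  · calc _ ≤ ∑ i, y i / M₀ * NE₀ (F (Complex.I * t) i) := Finset.sum_le_sum fun i _ => by
          rw [h₀.2.2.1]
          exact mul_le_mul_of_nonneg_right (norm_geomWeight_left _ (hy0' i) t) (h₀.1 _)
      _ = (∑ i, y i * NE₀ (F (Complex.I * t) i)) / M₀ := by
          rw [Finset.sum_div]; exact Finset.sum_congr rfl fun i _ => by ring
      _ ≤ c := by
          rw [div_le_iff₀ hM₀', mul_comm c]
          exact (hy _ fun i => h₀.1 _).trans (mul_le_mul_of_nonneg_left (F0 t) hM₀)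
  · calc _ ≤ ∑ i, u i / M₁ * NE₁ (F (1 + Complex.I * t) i) := Finset.sum_le_sum fun i _ => by
          rw [h₁.2.2.1]
          exact mul_le_mul_of_nonneg_right (norm_geomWeight_right _ (hu0' i) t) (h₁.1 _)
      _ = (∑ i, u i * NE₁ (F (1 + Complex.I * t) i)) / M₁ := by
          rw [Finset.sum_div]; exact Finset.sum_congr rfl fun i _ => by ring
      _ ≤ c := by
          rw [div_le_iff₀ hM₁', mul_comm c]
          exact (hu _ fun i => h₁.1 _).trans (mul_le_mul_of_nonneg_left (F1 t) hM₁)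

end Pairing

section Factorization
variable {J : Type*} [Fintype J] {n : ℕ}

/-- First-order condition: if `t ↦ ∑ rᵢ (1 + t wᵢ)^s` is maximal at `0`, its
derivative there is nonpositive. -/
lemma sum_mul_nonpos_of_rpow_le {r w : Fin n → ℝ} {s : ℝ} (hs : 0 < s)
    (h : ∀ t : ℝ, 0 < t → t ≤ 1 → ∑ i, r i * (1 + t * w i) ^ s ≤ ∑ i, r i) :
    ∑ i, r i * w i ≤ 0 := by
  have hd : HasDerivAt (fun t : ℝ => ∑ i, r i * (1 + t * w i) ^ s) (∑ i, r i * (w i * s)) 0 := by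
    refine HasDerivAt.fun_sum fun i _ => ?_
    have h1 : HasDerivAt (fun t : ℝ => 1 + t * w i) (w i) 0 := by
      simpa using ((hasDerivAt_id (0 : ℝ)).mul_const (w i)).const_add 1
    simpa using (h1.rpow_const (p := s) (Or.inl (by simp))).const_mul (r i)
  have h2 : ∑ i, r i * (w i * s) ≤ 0 := by
    refine le_of_tendsto hd.tendsto_slope_zero_right ?_
    filter_upwards [Ioo_mem_nhdsGT (zero_lt_one' ℝ)] with t ht
    have := h t ht.1 ht.2.le
    simp only [zero_add, zero_mul, add_zero, Real.one_rpow, mul_one, smul_eq_mul]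
    exact mul_nonpos_of_nonneg_of_nonpos (inv_nonneg.2 ht.1.le) (by linarith)
  rw [show ∑ i, r i * (w i * s) = s * ∑ i, r i * w i by
    rw [Finset.mul_sum]; exact Finset.sum_congr rfl fun i _ => by ring] at h2
  exact nonpos_of_mul_nonpos_right h2 hs

/-- Simultaneous linearization of a geometric mean bounded on a product of convex sets. -/
lemma exists_weights {s : J → ℝ} (hs : ∀ j, 0 < s j) (hs1 : ∑ j, s j = 1)
    {S : J → Set (Fin n → ℝ)} (hne : ∀ j, (S j).Nonempty) (hconv : ∀ j, Convex ℝ (S j))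
    (hpos : ∀ j, ∀ v ∈ S j, ∀ i, 0 ≤ v i) (hbdd : ∀ j, Bornology.IsBounded (S j)) {c c' : ℝ}
    (hc : ∀ v : J → Fin n → ℝ, (∀ j, v j ∈ S j) → ∑ i, ∏ j, v j i ^ s j ≤ c) (hcc : c < c') :
    ∃ ω : J → Fin n → ℝ, (∀ j i, 0 < ω j i) ∧ (∀ i, ∏ j, ω j i ^ s j = 1) ∧
      ∀ j, ∀ v ∈ S j, ∑ i, ω j i * v i ≤ c' := by
  classical
  let F : ℝ → (J → Fin n → ℝ) → ℝ := fun ε v => ∑ i, ∏ j, (v j i + ε) ^ s j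
  have hF : Continuous fun p : ℝ × (J → Fin n → ℝ) => F p.1 p.2 := by
    refine continuous_finsetSum _ fun i _ => continuous_finsetProd _ fun j _ => ?_
    exact (Real.continuous_rpow_const (hs j).le).comp (by fun_prop)
  let K : Set (J → Fin n → ℝ) := Set.univ.pi fun j => closure (S j)
  have hKc : IsCompact K := isCompact_univ_pi fun j => (hbdd j).isCompact_closure
  have hKne : K.Nonempty := Set.univ_pi_nonempty_iff.2 fun j => (hne j).closure
  have hKpos : ∀ v ∈ K, ∀ j i, 0 ≤ v j i := fun v hv j i => by
    have : closure (S j) ⊆ {v | 0 ≤ v i} := closure_minimal (fun v hv => hpos j v hv i)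
      (isClosed_le continuous_const (continuous_apply i))
    exact this (hv j trivial)
  have hK0 : ∀ v ∈ K, F 0 v ≤ c := by
    have : closure (Set.univ.pi S) ⊆ {v | F 0 v ≤ c} := by
      refine closure_minimal (fun v hv => ?_) (isClosed_le ?_ continuous_const)
      · simpa [F] using hc v fun j => hv j trivial
      · exact hF.comp (Continuous.prodMk_right (0 : ℝ))
    rw [closure_pi_set] at this
    exact fun v hv => this hv
  have hev : ∀ᶠ ε in nhds (0 : ℝ), ∀ v ∈ K, F ε v < c' :=
    hKc.eventually_forall_of_forall_eventually fun v hv =>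
      (hF.tendsto (0, v)).eventually_lt_const ((hK0 v hv).trans_lt hcc)
  obtain ⟨ε, hεK, hε⟩ : ∃ ε : ℝ, (∀ v ∈ K, F ε v < c') ∧ 0 < ε :=
    ((hev.filter_mono nhdsWithin_le_nhds).and
      (self_mem_nhdsWithin (a := (0 : ℝ)) (s := Set.Ioi 0))).exists
  obtain ⟨m, hm, hmax⟩ := hKc.exists_isMaxOn hKne
    (hF.comp (Continuous.prodMk_right ε)).continuousOn
  have hmax' : ∀ v ∈ K, F ε v ≤ F ε m := fun v hv => hmax hv
  have hmε : ∀ j i, 0 < m j i + ε := fun j i => add_pos_of_nonneg_of_pos (hKpos m hm j i) hε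
  let r : Fin n → ℝ := fun i => ∏ j, (m j i + ε) ^ s j
  have hr : ∀ i, 0 < r i := fun i => Finset.prod_pos fun j _ => Real.rpow_pos_of_pos (hmε j i) _
  refine ⟨fun j i => r i / (m j i + ε), fun j i => div_pos (hr i) (hmε j i), fun i => ?_,
    fun j v hv => ?_⟩
  · simp only [Real.div_rpow (hr i).le (hmε _ i).le]
    rw [Finset.prod_div_distrib, ← Real.rpow_sum_of_pos (hr i), hs1, Real.rpow_one]
    exact div_self (hr i).ne'
  · have hvK : ∀ t : ℝ, 0 < t → t ≤ 1 → Function.update m j (m j + t • (v - m j)) ∈ K := by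
      intro t ht ht1 j' _
      rcases eq_or_ne j' j with rfl | hj
      · rw [Function.update_self]
        exact (hconv j').closure.add_smul_sub_mem (hm j' trivial) (subset_closure hv) ⟨ht.le, ht1⟩
      · rw [Function.update_of_ne hj]
        exact hm j' trivial
    have hv0 := hpos j v hv
    have hfirst := sum_mul_nonpos_of_rpow_le (r := r) (w := fun i => (v i - m j i) / (m j i + ε))
      (hs j) fun t ht ht1 => by
        refine le_trans ?_ (hmax' _ (hvK t ht ht1))
        refine (Finset.sum_congr rfl fun i _ => ?_).le
        have h1 := hmε j i
        have h2 : 1 + t * ((v i - m j i) / (m j i + ε)) =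
            (m j i + t * (v i - m j i) + ε) / (m j i + ε) := by
          field_simp; ring
        have h3 : 0 ≤ m j i + t * (v i - m j i) + ε := by
          nlinarith [mul_nonneg ht.le (hv0 i), mul_nonneg (sub_nonneg.2 ht1) (hKpos m hm j i)]
        have h4 := (Real.rpow_pos_of_pos h1 (s j)).ne'
        have h5 : ∏ j' ∈ Finset.univ.erase j,
            (Function.update m j (m j + t • (v - m j)) j' i + ε) ^ s j' =
            ∏ j' ∈ Finset.univ.erase j, (m j' i + ε) ^ s j' :=
          Finset.prod_congr rfl fun j' hj' => by
            rw [Function.update_of_ne (Finset.ne_of_mem_erase hj')]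
        simp only [r]
        rw [h2, Real.div_rpow h3 h1.le, ← Finset.mul_prod_erase _ _ (Finset.mem_univ j),
          ← Finset.mul_prod_erase _ _ (Finset.mem_univ j), Function.update_self, h5]
        simp only [Pi.add_apply, Pi.smul_apply, Pi.sub_apply, smul_eq_mul]
        field_simp
    calc ∑ i, r i / (m j i + ε) * v i
        ≤ ∑ i, (r i + r i * ((v i - m j i) / (m j i + ε))) := Finset.sum_le_sum fun i _ => by
          have h1 := hmε j i
          have h2 := hr i
          rw [show r i + r i * ((v i - m j i) / (m j i + ε)) = r i / (m j i + ε) * (v i + ε) by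
            field_simp; ring]
          exact mul_le_mul_of_nonneg_left (by linarith) (by positivity)
      _ ≤ F ε m := by
          rw [Finset.sum_add_distrib]
          exact add_le_of_nonpos_right hfirst
      _ ≤ c' := (hεK m hm).le

end Factorization

section SquareHull
variable {n : ℕ}

/-- The convex hull of the coordinatewise squares of a set of vectors. -/
def sqHull (Y : Set (Fin n → ℝ)) : Set (Fin n → ℝ) :=
  convexHull ℝ (Set.image (fun y i => y i ^ 2) Y)

lemma sq_mem_sqHull {Y : Set (Fin n → ℝ)} {y : Fin n → ℝ} (hy : y ∈ Y) :
    (fun i => y i ^ 2) ∈ sqHull Y :=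
  subset_convexHull ℝ _ ⟨y, hy, rfl⟩

lemma exists_fin_of_mem_sqHull {Y : Set (Fin n → ℝ)} {q : Fin n → ℝ} (hq : q ∈ sqHull Y) :
    ∃ (m : ℕ) (t : Fin m → ℝ) (y : Fin m → Fin n → ℝ), (∀ j, 0 ≤ t j) ∧ ∑ j, t j = 1 ∧
      (∀ j, y j ∈ Y) ∧ ∀ i, q i = ∑ j, t j * y j i ^ 2 := by
  obtain ⟨ι, _, w, z, hw, hw1, hz, rfl⟩ := mem_convexHull_iff_exists_fintype.1 hq
  choose y hy hyz using hz
  let σ := (Fintype.equivFin ι).symm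
  refine ⟨_, fun j => w (σ j), fun j => y (σ j), fun j => hw _, by rwa [σ.sum_comp w],
    fun j => hy _, fun i => ?_⟩
  rw [σ.sum_comp fun j => w j * y j i ^ 2, Finset.sum_apply]
  exact Finset.sum_congr rfl fun j _ => by rw [← hyz]; rfl

lemma sqHull_nonneg {Y : Set (Fin n → ℝ)} {q : Fin n → ℝ} (hq : q ∈ sqHull Y) (i : Fin n) :
    0 ≤ q i := by
  obtain ⟨m, t, y, ht, -, -, h⟩ := exists_fin_of_mem_sqHull hq
  rw [h]
  exact Finset.sum_nonneg fun j _ => mul_nonneg (ht j) (sq_nonneg _)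

lemma isBounded_sqHull {Y : Set (Fin n → ℝ)} {B : Fin n → ℝ} (hB : ∀ y ∈ Y, ∀ i, |y i| ≤ B i) :
    Bornology.IsBounded (sqHull Y) := by
  refine isBounded_convexHull.2 (Bornology.forall_isBounded_image_eval_iff.1 fun i => ?_)
  refine (Metric.isBounded_Icc 0 (B i ^ 2)).subset ?_
  rintro _ ⟨_, ⟨y, hy, rfl⟩, rfl⟩
  exact ⟨sq_nonneg _, sq_le_sq' (by linarith [neg_abs_le (y i), hB y hy i])
    ((le_abs_self _).trans (hB y hy i))⟩

lemma sqHull_nonempty {Y : Set (Fin n → ℝ)} (hY : Y.Nonempty) : (sqHull Y).Nonempty :=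
  (hY.image _).convexHull

end SquareHull

section DualBall
variable {n : ℕ} {N : (Fin n → ℝ) → ℝ}

/-- The unit ball of the dual of `(ℝⁿ, N)`. -/
def dualBall (N : (Fin n → ℝ) → ℝ) : Set (Fin n → ℝ) := {y | ∀ x, ∑ i, y i * x i ≤ N x}

lemma zero_mem_dualBall (h : IsLatticeNorm N) : (0 : Fin n → ℝ) ∈ dualBall N := fun x => by
  simpa using h.1 x

lemma abs_le_of_mem_dualBall (h : IsLatticeNorm N) {y : Fin n → ℝ} (hy : y ∈ dualBall N)
    (i : Fin n) : |y i| ≤ N (Pi.single i 1) := by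
  refine abs_le'.2 ⟨by simpa [Pi.single_apply] using hy (Pi.single i 1), ?_⟩
  have h1 := hy (-Pi.single i 1)
  have h2 := h.2.2.1 (-1) (Pi.single i 1)
  rw [neg_one_smul, abs_neg, abs_one, one_mul] at h2
  rw [h2] at h1
  simpa [Pi.single_apply] using h1

lemma sum_abs_mul_le_of_mem_dualBall (h : IsLatticeNorm N) {y : Fin n → ℝ} (hy : y ∈ dualBall N)
    (g : Fin n → ℝ) : ∑ i, |y i| * g i ≤ N g := by
  have h1 := hy fun i => SignType.sign (y i) * g i
  refine (le_of_eq (Finset.sum_congr rfl fun i _ => ?_)).trans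
    (h1.trans (h.2.2.2.2 _ _ fun i => ?_))
  · rw [← mul_assoc, self_mul_sign]
  · rw [abs_mul]
    refine mul_le_of_le_one_left (abs_nonneg _) ?_
    rcases lt_trichotomy (y i) 0 with hi | hi | hi <;> simp [hi]

/-- The dual of a `2`-concave lattice is `2`-convex. -/
lemma sum_sqrt_mul_le_of_mem_sqHull (h : IsLatticeNorm N) {M : ℝ} (hc : ConcaveWith 2 M N)
    {q : Fin n → ℝ} (hq : q ∈ sqHull (dualBall N)) (hM : 0 ≤ M) (g : Fin n → ℝ) :
    ∑ i, √(q i) * g i ≤ M * N g := by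
  have hq0 := fun i => sqHull_nonneg hq i
  obtain ⟨m, t, y, ht, ht1, hy, hqi⟩ := exists_fin_of_mem_sqHull hq
  let G : Fin m → Fin n → ℝ := fun j i => g i * (√(t j) * |y j i|) / √(q i)
  have hG : ∀ i, ∑ j, |G j i| ^ (2 : ℝ) ≤ g i ^ 2 := fun i => by
    have : ∀ j, |G j i| ^ (2 : ℝ) = g i ^ 2 / q i * (t j * y j i ^ 2) := fun j => by
      rw [Real.rpow_two, sq_abs]
      simp only [G, div_pow, mul_pow, Real.sq_sqrt (ht j), Real.sq_sqrt (hq0 i), sq_abs]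
      ring
    simp only [this]
    rw [← Finset.mul_sum, ← hqi]
    rcases (hq0 i).eq_or_lt with h0 | h0
    · rw [← h0]; simpa using sq_nonneg _
    · rw [div_mul_cancel₀ _ h0.ne']
  have hconc := hc m G
  rw [← Real.sqrt_eq_rpow] at hconc
  calc ∑ i, √(q i) * g i = ∑ i, ∑ j, √(t j) * (|y j i| * G j i) := by
        refine Finset.sum_congr rfl fun i _ => ?_
        have : ∀ j, √(t j) * (|y j i| * G j i) = g i / √(q i) * (t j * y j i ^ 2) := fun j => by
          simp only [G]
          rw [← sq_abs (y j i)]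
          nth_rw 3 [← Real.mul_self_sqrt (ht j)]
          ring
        simp only [this]
        rw [← Finset.mul_sum, ← hqi]
        rcases (hq0 i).eq_or_lt with h0 | h0
        · rw [← h0]; simp
        · have h1 := (Real.sqrt_pos.2 h0).ne'
          nth_rw 3 [← Real.mul_self_sqrt h0.le]
          field_simp
    _ = ∑ j, √(t j) * ∑ i, |y j i| * G j i := by
        rw [Finset.sum_comm]; simp only [Finset.mul_sum]
    _ ≤ ∑ j, √(t j) * N (G j) := Finset.sum_le_sum fun j _ =>
        mul_le_mul_of_nonneg_left (sum_abs_mul_le_of_mem_dualBall h (hy j) _) (Real.sqrt_nonneg _)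
    _ ≤ √(∑ j, √(t j) ^ 2) * √(∑ j, N (G j) ^ 2) := Real.sum_mul_le_sqrt_mul_sqrt _ _ _
    _ = √(∑ j, N (G j) ^ 2) := by simp only [Real.sq_sqrt (ht _), ht1, Real.sqrt_one, one_mul]
    _ ≤ M * N fun i => (∑ j, |G j i| ^ (2 : ℝ)) ^ (1 / (2 : ℝ)) := by
        simpa only [Real.rpow_two] using hconc
    _ ≤ M * N g := mul_le_mul_of_nonneg_left (h.2.2.2.2 _ _ fun i => by
        rw [← Real.sqrt_eq_rpow, abs_of_nonneg (Real.sqrt_nonneg _)]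
        exact (Real.sqrt_le_sqrt (hG i)).trans_eq (Real.sqrt_sq_eq_abs _)) hM

lemma exists_mem_dualBall_eq (h : IsLatticeNorm N) (v : Fin n → ℝ) :
    ∃ y ∈ dualBall N, ∑ i, y i * v i = N v := by
  rcases eq_or_ne v 0 with rfl | hv
  · have : N 0 = 0 := by simpa using h.2.2.1 0 0
    exact ⟨0, zero_mem_dualBall h, by simp [this]⟩
  obtain ⟨g, hg, hgN⟩ := exists_extension_of_le_sublinear
    (LinearPMap.mkSpanSingleton' (σ := RingHom.id ℝ) v (N v) fun c hc => by
      simp [(smul_eq_zero.1 hc).resolve_right hv]) N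
    (fun c hc x => by rw [h.2.2.1, abs_of_pos hc]) h.2.2.2.1 (by
      rintro ⟨x, hx⟩
      obtain ⟨c, rfl⟩ := Submodule.mem_span_singleton.1 hx
      rw [LinearPMap.mkSpanSingleton'_apply, h.2.2.1]
      exact mul_le_mul_of_nonneg_right (le_abs_self c) (h.1 v))
  have hsum : ∀ x, ∑ i, g (fun j => if i = j then 1 else 0) * x i = g x := fun x => by
    rw [LinearMap.pi_apply_eq_sum_univ g x]
    exact Finset.sum_congr rfl fun i _ => mul_comm _ _
  refine ⟨fun i => g fun j => if i = j then 1 else 0, fun x => (hsum x).trans_le (hgN x), ?_⟩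
  have := hg ⟨(1 : ℝ) • v, Submodule.smul_mem _ _ (Submodule.mem_span_singleton_self v)⟩
  rw [LinearPMap.mkSpanSingleton'_apply] at this
  rw [hsum]
  simpa using this

/-- A diagonal map from `ℓ₂` whose squared symbol is bounded on the squares of the dual ball. -/
lemma latticeNorm_sqrt_mul_le (h : IsLatticeNorm N) {ω : Fin n → ℝ} {c : ℝ} (hω : ∀ i, 0 ≤ ω i)
    (hq : ∀ q ∈ sqHull (dualBall N), ∑ i, ω i * q i ≤ c) (μ : Fin n → ℝ) :
    N (fun i => √(ω i) * μ i) ≤ √c * √(∑ i, μ i ^ 2) := by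
  obtain ⟨y, hy, e⟩ := exists_mem_dualBall_eq h fun i => √(ω i) * μ i
  rw [← e]
  calc _ = ∑ i, (√(ω i) * y i) * μ i := Finset.sum_congr rfl fun i _ => by ring
    _ ≤ √(∑ i, (√(ω i) * y i) ^ 2) * √(∑ i, μ i ^ 2) := Real.sum_mul_le_sqrt_mul_sqrt _ _ _
    _ ≤ _ := mul_le_mul_of_nonneg_right (Real.sqrt_le_sqrt (by
        simpa only [mul_pow, Real.sq_sqrt (hω _)] using hq _ (sq_mem_sqHull hy)))
        (Real.sqrt_nonneg _)

end DualBall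

section Weights
variable {V : Type*} [NormedAddCommGroup V] [NormedSpace ℂ V]
  {H : Type*} [NormedAddCommGroup H] [InnerProductSpace ℂ H]
  {NE₀ NE₁ : V → ℝ} {θ : ℝ} {n : ℕ} {NX₀ NX₁ : (Fin n → ℝ) → ℝ}

lemma cubeAvg_sum_mul {m : ℕ} (f : Fin n → (Fin m → Bool) → ℝ) (w : Fin n → ℝ) :
    ∑ i, cubeAvg (f i) * w i = cubeAvg fun ε => ∑ i, f i ε * w i := by
  unfold cubeAvg
  rw [Finset.sum_comm, Finset.mul_sum]
  exact Finset.sum_congr rfl fun i _ => by rw [← Finset.sum_mul, mul_assoc]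

lemma map_signSum {F W W' : Type*} [AddCommGroup W] [AddCommGroup W'] [FunLike F W W']
    [AddMonoidHomClass F W W'] (L : F) {m : ℕ} (x : Fin m → W) (ε : Fin m → Bool) :
    L (signSum x ε) = signSum (fun j => L (x j)) ε := by
  unfold signSum
  rw [map_sum]
  exact Finset.sum_congr rfl fun j _ => by split_ifs <;> simp

lemma sqrt_sum_sq_le_cubeAvg {N : V → ℝ} (h0 : ∀ x, 0 ≤ N x)
    (hs : ∀ (c : ℂ) x, N (c • x) = ‖c‖ * N x) (ha : ∀ x y, N (x + y) ≤ N x + N y) {C : ℝ}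
    (hC : 0 ≤ C) (hcot : Cotype2With N C) {m : ℕ} (x : Fin m → V) :
    √(∑ j, N (x j) ^ 2) ≤ √2 * C * cubeAvg fun ε => N (signSum x ε) := by
  let _ : NormedSpace ℝ V := NormedSpace.restrictScalars ℝ ℂ V
  have hk := kahane_two N h0 (fun c x => by
    have := hs c x
    rw [Complex.norm_real, Real.norm_eq_abs] at this
    exact this) ha x
  have havg : 0 ≤ cubeAvg fun ε => N (signSum x ε) :=
    mul_nonneg (by positivity) (Finset.sum_nonneg fun _ _ => h0 _)
  calc √(∑ j, N (x j) ^ 2) ≤ C * √(radAvg N x) := hcot m x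
    _ ≤ C * √(2 * (cubeAvg fun ε => N (signSum x ε)) ^ 2) :=
        mul_le_mul_of_nonneg_left (Real.sqrt_le_sqrt hk) hC
    _ = _ := by rw [Real.sqrt_mul two_pos.le, Real.sqrt_sq havg]; ring

variable [FiniteDimensional ℂ V]

lemma sum_sqrt_mul_le_of_cotype (hθ : 0 < θ) (hθ1 : θ < 1) (hX₀ : IsLatticeNorm NX₀)
    (hX₁ : IsLatticeNorm NX₁) {M₀ M₁ : ℝ} (hM₀ : 0 ≤ M₀) (hM₁ : 0 ≤ M₁)
    (hc₀ : ConcaveWith 2 M₀ NX₀) (hc₁ : ConcaveWith 2 M₁ NX₁)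
    (h₀ : IsNormC NE₀) (h₁ : IsNormC NE₁) {C : ℝ} (hC : 0 ≤ C)
    (hcot : Cotype2With (interpN θ NE₀ NE₁) C) (T : H →ₗ[ℂ] Fin n → V)
    (hT : ∀ x, interpN θ (vecLatNorm NX₀ NE₀) (vecLatNorm NX₁ NE₁) (T x) ≤ ‖x‖)
    {b q₀ q₁ : Fin n → ℝ}
    (hb : b ∈ sqHull {y | ∃ x : H, ‖x‖ ≤ 1 ∧ y = fun i => interpN θ NE₀ NE₁ (T x i)})
    (hq₀ : q₀ ∈ sqHull (dualBall NX₀)) (hq₁ : q₁ ∈ sqHull (dualBall NX₁)) :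
    ∑ i, √(b i) * (√(q₀ i) ^ (1 - θ) * √(q₁ i) ^ θ) ≤ √2 * C * M₀ ^ (1 - θ) * M₁ ^ θ := by
  set E := interpN θ NE₀ NE₁ with hE
  set w : Fin n → ℝ := fun i => √(q₀ i) ^ (1 - θ) * √(q₁ i) ^ θ with hw
  have hw0 : ∀ i, 0 ≤ w i := fun i => by positivity
  obtain ⟨m, t, y, ht, ht1, hy, hbi⟩ := exists_fin_of_mem_sqHull hb
  choose x hx hyx using hy
  let z : Fin m → H := fun j => ((√(t j) : ℝ) : ℂ) • x j
  have hz : ∑ j, ‖z j‖ ^ 2 ≤ 1 := by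
    rw [← ht1]
    refine Finset.sum_le_sum fun j _ => ?_
    rw [norm_smul, mul_pow, Complex.norm_real, Real.norm_of_nonneg (Real.sqrt_nonneg _),
      Real.sq_sqrt (ht j)]
    exact mul_le_of_le_one_right (ht j) (pow_le_one₀ (norm_nonneg _) (hx j))
  have hEs : ∀ (c : ℂ) v, E (c • v) = ‖c‖ * E v := interpN_smul h₀ h₁
  have hbz : ∀ i, b i = ∑ j, E (T (z j) i) ^ 2 := fun i => by
    rw [hbi]
    refine Finset.sum_congr rfl fun j _ => ?_
    rw [hyx, map_smul, Pi.smul_apply, hEs, mul_pow, Complex.norm_real,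
      Real.norm_of_nonneg (Real.sqrt_nonneg _), Real.sq_sqrt (ht j)]
  calc ∑ i, √(b i) * w i
      ≤ ∑ i, √2 * C * ((cubeAvg fun ε => E (T (signSum z ε) i)) * w i) :=
        Finset.sum_le_sum fun i _ => by
          rw [← mul_assoc (√2 * C), hbz]
          refine mul_le_mul_of_nonneg_right ?_ (hw0 i)
          refine (sqrt_sum_sq_le_cubeAvg (interpN_nonneg h₀.1) hEs (interpN_add_le h₀ h₁) hC hcot
            _).trans_eq ?_
          congr 2
          funext ε
          congr 1
          exact (map_signSum ((LinearMap.proj (R := ℂ) (φ := fun _ : Fin n => V) i).comp T)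
            z ε).symm
    _ = √2 * C * cubeAvg fun ε => ∑ i, E (T (signSum z ε) i) * w i := by
        rw [← Finset.mul_sum, cubeAvg_sum_mul]
    _ ≤ √2 * C * cubeAvg fun ε => M₀ ^ (1 - θ) * M₁ ^ θ * ‖signSum z ε‖ := by
        refine mul_le_mul_of_nonneg_left (cubeAvg_mono fun ε => ?_) (by positivity)
        refine (sum_interpN_mul_le hθ hθ1 h₀ h₁ hM₀ hM₁ (fun i => Real.sqrt_nonneg _)
          (fun i => Real.sqrt_nonneg _) (fun g _ => sum_sqrt_mul_le_of_mem_sqHull hX₀ hc₀ hq₀ hM₀ g)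
          (fun g _ => sum_sqrt_mul_le_of_mem_sqHull hX₁ hc₁ hq₁ hM₁ g) _).trans ?_
        exact mul_le_mul_of_nonneg_left (hT _) (by positivity)
    _ = √2 * C * M₀ ^ (1 - θ) * M₁ ^ θ * cubeAvg fun ε => ‖signSum z ε‖ := by
        rw [cubeAvg_const_mul]; ring
    _ ≤ _ := by
        refine mul_le_of_le_one_right (by positivity) ((cubeAvg_norm_signSum_le z).trans ?_)
        exact Real.sqrt_le_one.2 hz

/-- Weights factoring an operator of norm at most one through a weighted `ℓ₂`-sum. -/
lemma exists_lattice_weights (hθ : 0 < θ) (hθ1 : θ < 1) (hX₀ : IsLatticeNorm NX₀)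
    (hX₁ : IsLatticeNorm NX₁) {M₀ M₁ : ℝ} (hM₀ : 0 ≤ M₀) (hM₁ : 0 ≤ M₁)
    (hc₀ : ConcaveWith 2 M₀ NX₀) (hc₁ : ConcaveWith 2 M₁ NX₁)
    (h₀ : IsNormC NE₀) (h₁ : IsNormC NE₁) {C : ℝ} (hC : 0 ≤ C)
    (hcot : Cotype2With (interpN θ NE₀ NE₁) C) (T : H →L[ℂ] Fin n → V)
    (hT : ∀ x, interpN θ (vecLatNorm NX₀ NE₀) (vecLatNorm NX₁ NE₁) (T x) ≤ ‖x‖) {c : ℝ}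
    (hc : √2 * C * M₀ ^ (1 - θ) * M₁ ^ θ < c) :
    ∃ a w₀ w₁ : Fin n → ℝ, (∀ i, 0 < a i) ∧ (∀ i, 0 < w₀ i) ∧ (∀ i, 0 < w₁ i) ∧
      (∀ i, a i * (w₀ i ^ (1 - θ) * w₁ i ^ θ) = 1) ∧
      (∀ x : H, ‖x‖ ≤ 1 → √(∑ i, (a i * interpN θ NE₀ NE₁ (T x i)) ^ 2) ≤ √c) ∧
      (∀ μ : Fin n → ℝ, NX₀ (fun i => w₀ i * μ i) ≤ √c * √(∑ i, μ i ^ 2)) ∧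
      ∀ μ : Fin n → ℝ, NX₁ (fun i => w₁ i * μ i) ≤ √c * √(∑ i, μ i ^ 2) := by
  have hθ' := sub_pos.2 hθ1
  set A := {y : Fin n → ℝ | ∃ x : H, ‖x‖ ≤ 1 ∧ y = fun i => interpN θ NE₀ NE₁ (T x i)}
  let Y : Fin 3 → Set (Fin n → ℝ) := ![A, dualBall NX₀, dualBall NX₁]
  let s : Fin 3 → ℝ := ![1 / 2, 1 / 2 * (1 - θ), 1 / 2 * θ]
  have hYne : ∀ j, (Y j).Nonempty := by
    intro j
    fin_cases j
    exacts [⟨_, 0, by simp, rfl⟩, ⟨0, zero_mem_dualBall hX₀⟩, ⟨0, zero_mem_dualBall hX₁⟩]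
  obtain ⟨κ, hκ, hκE⟩ := h₀.exists_le_norm
  obtain ⟨κ', hκ', hκE'⟩ := h₁.exists_le_norm
  have hYb : ∀ j, Bornology.IsBounded (sqHull (Y j)) := by
    intro j
    fin_cases j
    · refine isBounded_sqHull (B := fun _ => max κ κ' * ‖T‖) ?_
      rintro _ ⟨x, hx, rfl⟩ i
      rw [abs_of_nonneg (interpN_nonneg h₀.1 _)]
      have h1 : ‖T x i‖ ≤ ‖T‖ :=
        (norm_le_pi_norm _ i).trans ((T.le_opNorm x).trans (mul_le_of_le_one_right
          (norm_nonneg _) hx))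
      refine (interpN_le_max h₀.1 _).trans (max_le ((hκE _).trans ?_) ((hκE' _).trans ?_))
      · exact mul_le_mul (le_max_left _ _) h1 (norm_nonneg _) (by positivity)
      · exact mul_le_mul (le_max_right _ _) h1 (norm_nonneg _) (by positivity)
    · exact isBounded_sqHull fun y hy i => abs_le_of_mem_dualBall hX₀ hy i
    · exact isBounded_sqHull fun y hy i => abs_le_of_mem_dualBall hX₁ hy i
  obtain ⟨ω, hω, hω1, hωq⟩ := exists_weights (s := s) (S := fun j => sqHull (Y j))
    (by intro j; fin_cases j <;> simp [s, hθ, hθ1])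
    (by simp only [s, Fin.sum_univ_three, Matrix.cons_val]; ring)
    (fun j => sqHull_nonempty (hYne j)) (fun j => convex_convexHull ℝ _)
    (fun j q hq => sqHull_nonneg hq) hYb (fun v hv => by
      refine le_of_eq_of_le (Finset.sum_congr rfl fun i _ => ?_)
        (sum_sqrt_mul_le_of_cotype hθ hθ1 hX₀ hX₁ hM₀ hM₁ hc₀ hc₁ h₀ h₁ hC hcot T.toLinearMap hT
          (hv 0) (hv 1) (hv 2))
      simp only [s, Fin.prod_univ_three, Matrix.cons_val]
      rw [Real.rpow_mul (sqHull_nonneg (hv 1) i), Real.rpow_mul (sqHull_nonneg (hv 2) i),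
        ← Real.sqrt_eq_rpow, ← Real.sqrt_eq_rpow, ← Real.sqrt_eq_rpow, mul_assoc]) hc
  refine ⟨fun i => √(ω 0 i), fun i => √(ω 1 i), fun i => √(ω 2 i),
    fun i => Real.sqrt_pos.2 (hω _ _), fun i => Real.sqrt_pos.2 (hω _ _),
    fun i => Real.sqrt_pos.2 (hω _ _), fun i => ?_, fun x hx => ?_,
    latticeNorm_sqrt_mul_le hX₀ (fun i => (hω 1 i).le) (hωq 1),
    latticeNorm_sqrt_mul_le hX₁ (fun i => (hω 2 i).le) (hωq 2)⟩
  · have := hω1 i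
    simp only [s, Fin.prod_univ_three, Matrix.cons_val] at this
    rwa [Real.rpow_mul (hω 1 i).le, Real.rpow_mul (hω 2 i).le, ← Real.sqrt_eq_rpow,
      ← Real.sqrt_eq_rpow, ← Real.sqrt_eq_rpow, mul_assoc] at this
  · refine Real.sqrt_le_sqrt ?_
    simp only [mul_pow, Real.sq_sqrt (hω 0 _).le]
    exact hωq 0 _ (sq_mem_sqHull (Y := A) ⟨x, hx, rfl⟩)

end Weights

lemma le_of_forall_pos_le_of_continuous {a : ℝ} {f : ℝ → ℝ} (hf : Continuous f)
    (h : ∀ η, 0 < η → a ≤ f η) : a ≤ f 0 := by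
  refine ge_of_tendsto ((hf.tendsto 0).mono_left (nhdsWithin_le_nhds (s := Set.Ioi 0))) ?_
  filter_upwards [self_mem_nhdsWithin] with η hη using h η hη

section OperatorNorm
variable {V : Type*} [NormedAddCommGroup V] [NormedSpace ℂ V] {N : V → ℝ}

lemma le_opN {κ : ℝ} (hκ : 0 ≤ κ) (hN : ∀ v, N v ≤ κ * ‖v‖) (S : Hilb →L[ℂ] V) {x : Hilb}
    (hx : ‖x‖ ≤ 1) : N (S x) ≤ opN hilbNorm N S := by
  refine le_csSup ⟨κ * ‖S‖, ?_⟩ ⟨x, hx, rfl⟩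
  rintro _ ⟨y, hy, rfl⟩
  refine (hN _).trans (mul_le_mul_of_nonneg_left ?_ hκ)
  exact (S.le_opNorm y).trans (mul_le_of_le_one_right (norm_nonneg _) hy)

lemma opN_le {S : Hilb →L[ℂ] V} {B : ℝ} (hB : 0 ≤ B) (h : ∀ x : Hilb, ‖x‖ ≤ 1 → N (S x) ≤ B) :
    opN hilbNorm N S ≤ B :=
  Real.sSup_le (by rintro _ ⟨x, hx, rfl⟩; exact h x hx) hB

lemma opN_nonneg (hN : ∀ v, 0 ≤ N v) (S : Hilb →L[ℂ] V) : 0 ≤ opN hilbNorm N S :=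
  Real.sSup_nonneg fun _ ⟨_, _, h⟩ => h ▸ hN _

end OperatorNorm

section DTheta
variable {V : Type*} [NormedAddCommGroup V] [NormedSpace ℂ V] {N₀ N₁ : V → ℝ} {θ : ℝ}

lemma dTheta_nonneg (h₀ : ∀ v, 0 ≤ N₀ v) : 0 ≤ dTheta θ N₀ N₁ :=
  Real.sSup_nonneg fun _ ⟨_, _, h⟩ => h ▸ interpN_nonneg (fun S => opN_nonneg h₀ S) _

variable [FiniteDimensional ℂ V]

lemma exists_interpN_le_norm (h₀ : IsNormC N₀) (h₁ : IsNormC N₁) :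
    ∃ κ : ℝ, 0 ≤ κ ∧ ∀ v, interpN θ N₀ N₁ v ≤ κ * ‖v‖ := by
  obtain ⟨κ₀, hκ₀, hκ₀'⟩ := h₀.exists_le_norm
  obtain ⟨κ₁, hκ₁, hκ₁'⟩ := h₁.exists_le_norm
  refine ⟨max κ₀ κ₁, by positivity, fun v => (interpN_le_max h₀.1 v).trans (max_le ?_ ?_)⟩
  · exact (hκ₀' v).trans (mul_le_mul_of_nonneg_right (le_max_left _ _) (norm_nonneg _))
  · exact (hκ₁' v).trans (mul_le_mul_of_nonneg_right (le_max_right _ _) (norm_nonneg _))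

lemma interpN_apply_le_norm (h₀ : IsNormC N₀) (h₁ : IsNormC N₁) {T : Hilb →L[ℂ] V}
    (hT : opN hilbNorm (interpN θ N₀ N₁) T ≤ 1) (x : Hilb) : interpN θ N₀ N₁ (T x) ≤ ‖x‖ := by
  obtain ⟨κ, hκ, hκ'⟩ := exists_interpN_le_norm (θ := θ) h₀ h₁
  rcases eq_or_ne x 0 with rfl | hx
  · have := interpN_smul (θ := θ) h₀ h₁ 0 (T 0)
    simp only [map_zero, smul_zero, norm_zero, zero_mul] at this ⊢
    exact this.le
  · have hp := norm_pos_iff.2 hx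
    have h1 : ‖(‖x‖ : ℂ)⁻¹ • x‖ ≤ 1 := by simp [norm_smul, hp.ne']
    have := (le_opN hκ hκ' T h1).trans hT
    rw [map_smul, interpN_smul h₀ h₁, norm_inv, Complex.norm_real, norm_norm, inv_mul_eq_div,
      div_le_one hp] at this
    exact this

lemma interpN_opN_le_dTheta (hθ : 0 < θ) (hθ1 : θ < 1) (h₀ : IsNormC N₀) (h₁ : IsNormC N₁)
    {T : Hilb →L[ℂ] V} (hT : opN hilbNorm (interpN θ N₀ N₁) T ≤ 1) :
    interpN θ (fun S : Hilb →L[ℂ] V => opN hilbNorm N₀ S)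
      (fun S : Hilb →L[ℂ] V => opN hilbNorm N₁ S) T ≤ dTheta θ N₀ N₁ := by
  obtain ⟨κ₀, hκ₀, hκ₀'⟩ := h₀.exists_norm_le
  obtain ⟨κ₁, hκ₁, hκ₁'⟩ := h₁.exists_norm_le
  obtain ⟨c₀, hc₀, hc₀'⟩ := h₀.exists_le_norm
  obtain ⟨c₁, hc₁, hc₁'⟩ := h₁.exists_le_norm
  have hκ := lt_min hκ₀ hκ₁
  refine le_csSup ⟨max (c₀ * (min κ₀ κ₁)⁻¹) (c₁ * (min κ₀ κ₁)⁻¹), ?_⟩ ⟨T, hT, rfl⟩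
  rintro _ ⟨S, hS, rfl⟩
  have hSx : ∀ x : Hilb, ‖x‖ ≤ 1 → ‖S x‖ ≤ (min κ₀ κ₁)⁻¹ := fun x hx => by
    have h1 := le_interpN hθ hθ1 hκ
      (fun v => (mul_le_mul_of_nonneg_right (min_le_left κ₀ κ₁) (norm_nonneg v)).trans (hκ₀' v))
      (fun v => (mul_le_mul_of_nonneg_right (min_le_right κ₀ κ₁) (norm_nonneg v)).trans (hκ₁' v))
      (S x)
    rw [← one_div, le_div_iff₀ hκ, mul_comm]
    exact h1.trans ((interpN_apply_le_norm h₀ h₁ hS x).trans hx)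
  refine (interpN_le_max (fun S => opN_nonneg h₀.1 S) S).trans (max_le_max ?_ ?_)
  · exact opN_le (by positivity) fun x hx =>
      (hc₀' _).trans (mul_le_mul_of_nonneg_left (hSx x hx) hc₀.le)
  · exact opN_le (by positivity) fun x hx =>
      (hc₁' _).trans (mul_le_mul_of_nonneg_left (hSx x hx) hc₁.le)

end DTheta

section VectorLattice
variable {V : Type*} {n : ℕ} {NX : (Fin n → ℝ) → ℝ} {NE NE₀ NE₁ : V → ℝ} {θ : ℝ}

lemma isLatticeNorm_sqrt_sum_sq : IsLatticeNorm fun x : Fin n → ℝ => √(∑ i, x i ^ 2) := by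
  have hnorm : (fun x : Fin n → ℝ => √(∑ i, x i ^ 2)) =
      fun x => ‖(WithLp.toLp 2 x : EuclideanSpace ℝ (Fin n))‖ := by
    funext x
    simp [EuclideanSpace.norm_eq]
  refine ⟨fun x => Real.sqrt_nonneg _, ?_, ?_, ?_, fun x y h => Real.sqrt_le_sqrt
    (Finset.sum_le_sum fun i _ => sq_le_sq.2 (h i))⟩ <;> rw [hnorm]
  · intro x hx
    simpa using hx
  · intro c x
    simp only [WithLp.toLp_smul, norm_smul, Real.norm_eq_abs]
  · intro x y
    simp only [WithLp.toLp_add]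
    exact norm_add_le _ _

lemma l2nNorm_mono {x : Fin n → V} (hE : ∀ v, 0 ≤ NE v) {c : Fin n → ℝ}
    (h : ∀ i, NE (x i) ≤ c i) : l2nNorm NE x ≤ √(∑ i, c i ^ 2) :=
  Real.sqrt_le_sqrt (Finset.sum_le_sum fun i _ => pow_le_pow_left₀ (hE _) (h i) 2)

variable [AddCommGroup V] [Module ℂ V]

lemma isNormC_vecLatNorm (hX : IsLatticeNorm NX) (hE : IsNormC NE) :
    IsNormC (vecLatNorm NX NE : (Fin n → V) → ℝ) := by
  refine ⟨fun x => hX.1 _, fun x hx => ?_, fun c x => ?_, fun x y => ?_⟩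
  · exact funext fun i => hE.2.1 _ (congrFun (hX.2.1 _ hx) i)
  · have := hX.2.2.1 ‖c‖ fun i => NE (x i)
    rw [abs_norm] at this
    rw [vecLatNorm, vecLatNorm, ← this]
    congr 1
    exact funext fun i => hE.2.2.1 c (x i)
  · refine (hX.2.2.2.2 _ _ fun i => ?_).trans (hX.2.2.2.1 (fun i => NE (x i)) fun i => NE (y i))
    rw [abs_of_nonneg (hE.1 _)]
    exact (hE.2.2.2 _ _).trans (le_abs_self _)

lemma isNormC_l2nNorm (hE : IsNormC NE) : IsNormC (l2nNorm NE : (Fin n → V) → ℝ) :=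
  isNormC_vecLatNorm isLatticeNorm_sqrt_sum_sq hE

lemma interpN_l2nNorm_le (h₀ : IsNormC NE₀) (h₁ : IsNormC NE₁) (x : Fin n → V) :
    interpN θ (l2nNorm NE₀) (l2nNorm NE₁) x ≤ √(∑ i, interpN θ NE₀ NE₁ (x i) ^ 2) := by
  have key : ∀ η, 0 < η → interpN θ (l2nNorm NE₀) (l2nNorm NE₁) x ≤
      √(∑ i, (interpN θ NE₀ NE₁ (x i) + η) ^ 2) := fun η hη => by
    choose f hf hfx f0 f1 using fun i => exists_of_interpN_lt (lt_add_of_pos_right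
      (interpN θ NE₀ NE₁ (x i)) hη)
    have hF : FinType fun z i => f i z := by
      have := FinType.sum Finset.univ fun i => (hf i).map (LinearMap.single ℂ (fun _ => V) i)
      refine (congrArg FinType (funext fun z => ?_)).mp this
      ext i
      simp [Finset.sum_apply, Pi.single_apply]
    have := interpN_le (θ := θ) (isNormC_l2nNorm h₀).1 hF
      (fun t => l2nNorm_mono h₀.1 fun i => f0 i t) (fun t => l2nNorm_mono h₁.1 fun i => f1 i t)
    simpa only [hfx] using this
  simpa using le_of_forall_pos_le_of_continuous (by fun_prop) key

end VectorLattice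

section Diagonal
variable {V : Type*} [NormedAddCommGroup V] [NormedSpace ℂ V] {n : ℕ}

/-- The operator multiplying the `i`-th coordinate by `a i`. -/
def diagCLM (a : Fin n → ℂ) : (Fin n → V) →L[ℂ] Fin n → V :=
  ContinuousLinearMap.pi fun i => a i • ContinuousLinearMap.proj i

@[simp] lemma diagCLM_apply (a : Fin n → ℂ) (x : Fin n → V) (i : Fin n) :
    diagCLM a x i = a i • x i := rfl

lemma FinType.diagCLM_comp {F : ℂ → Hilb →L[ℂ] Fin n → V} (hF : FinType F) {a : Fin n → ℂ → ℂ}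
    (ha : ∀ i, Adm (a i)) : FinType fun z => (diagCLM fun i => a i z).comp (F z) := by
  classical
  have := FinType.sum Finset.univ fun i => (hF.map (ContinuousLinearMap.compL ℂ Hilb
    (Fin n → V) (Fin n → V) (diagCLM (Pi.single i 1))).toLinearMap).smul (ha i)
  refine (congrArg FinType (funext fun z => ?_)).mp this
  ext x i
  simp [Finset.sum_apply, Pi.single_apply]

end Diagonal

section Main
variable {V : Type*} [NormedAddCommGroup V] [NormedSpace ℂ V]
  {NE₀ NE₁ : V → ℝ} {θ : ℝ} {n : ℕ} {NX NX₀ NX₁ : (Fin n → ℝ) → ℝ}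

lemma vecLatNorm_smul_le {NE : V → ℝ} (hX : IsLatticeNorm NX) (hE : IsNormC NE) {c d : ℝ}
    (hc : 0 ≤ c) {w : Fin n → ℝ} (hw : ∀ μ : Fin n → ℝ,
      NX (fun i => w i * μ i) ≤ √c * √(∑ i, μ i ^ 2)) {g : Fin n → ℂ}
    (hg : ∀ i, ‖g i‖ ≤ √c * w i) {v : Fin n → V} (hv : l2nNorm NE v ≤ d) :
    vecLatNorm NX NE (fun i => g i • v i) ≤ c * d := by
  calc NX (fun i => NE (g i • v i)) ≤ NX (fun i => w i * (√c * NE (v i))) :=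
        hX.2.2.2.2 _ _ fun i => by
          rw [abs_of_nonneg (hE.1 _), hE.2.2.1]
          refine le_trans ?_ (le_abs_self _)
          rw [← mul_assoc, mul_comm (w i)]
          exact mul_le_mul_of_nonneg_right (hg i) (hE.1 _)
    _ ≤ √c * √(∑ i, (√c * NE (v i)) ^ 2) := hw _
    _ = c * l2nNorm NE v := by
        simp only [mul_pow]
        rw [← Finset.mul_sum, Real.sqrt_mul (sq_nonneg _), Real.sqrt_sq (Real.sqrt_nonneg _),
          ← mul_assoc, Real.mul_self_sqrt hc]
        rfl
    _ ≤ c * d := mul_le_mul_of_nonneg_left hv hc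

variable [FiniteDimensional ℂ V]

lemma interpN_opN_le (hθ : 0 < θ) (hθ1 : θ < 1) (hX₀ : IsLatticeNorm NX₀)
    (hX₁ : IsLatticeNorm NX₁) {M₀ M₁ : ℝ} (hM₀ : 0 ≤ M₀) (hM₁ : 0 ≤ M₁)
    (hc₀ : ConcaveWith 2 M₀ NX₀) (hc₁ : ConcaveWith 2 M₁ NX₁)
    (h₀ : IsNormC NE₀) (h₁ : IsNormC NE₁) {C : ℝ} (hC : 0 ≤ C)
    (hcot : Cotype2With (interpN θ NE₀ NE₁) C) {T : Hilb →L[ℂ] Fin n → V}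
    (hT : opN hilbNorm (interpN θ (vecLatNorm NX₀ NE₀) (vecLatNorm NX₁ NE₁)) T ≤ 1) {c ε : ℝ}
    (hc : √2 * C * M₀ ^ (1 - θ) * M₁ ^ θ < c) (hε : 0 < ε) :
    interpN θ (fun S : Hilb →L[ℂ] Fin n → V => opN hilbNorm (vecLatNorm NX₀ NE₀) S)
      (fun S : Hilb →L[ℂ] Fin n → V => opN hilbNorm (vecLatNorm NX₁ NE₁) S) T ≤
      c * (dTheta θ (l2nNorm NE₀ : (Fin n → V) → ℝ) (l2nNorm NE₁) + ε) := by
  have hl₀ : IsNormC (l2nNorm NE₀ : (Fin n → V) → ℝ) := isNormC_l2nNorm h₀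
  have hl₁ : IsNormC (l2nNorm NE₁ : (Fin n → V) → ℝ) := isNormC_l2nNorm h₁
  have hv₀ := isNormC_vecLatNorm hX₀ h₀
  have hv₁ := isNormC_vecLatNorm hX₁ h₁
  have hcpos : 0 < c := lt_of_le_of_lt (by positivity) hc
  have hsc : √c ≠ 0 := (Real.sqrt_pos.2 hcpos).ne'
  obtain ⟨a, w₀, w₁, ha, hw₀, hw₁, haw, hR, hb₀, hb₁⟩ := exists_lattice_weights hθ hθ1 hX₀ hX₁
    hM₀ hM₁ hc₀ hc₁ h₀ h₁ hC hcot T (interpN_apply_le_norm hv₀ hv₁ hT) hc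
  let R : Hilb →L[ℂ] Fin n → V := (diagCLM fun i => (((√c)⁻¹ * a i : ℝ) : ℂ)).comp T
  have hRop : opN hilbNorm (interpN θ (l2nNorm NE₀) (l2nNorm NE₁)) R ≤ 1 := by
    refine opN_le zero_le_one fun x hx => (interpN_l2nNorm_le h₀ h₁ _).trans ?_
    have h1 : ∀ i, interpN θ NE₀ NE₁ (R x i) ^ 2 =
        (√c)⁻¹ ^ 2 * (a i * interpN θ NE₀ NE₁ (T x i)) ^ 2 := fun i => by
      rw [show R x i = (((√c)⁻¹ * a i : ℝ) : ℂ) • T x i from rfl, interpN_smul h₀ h₁,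
        Complex.norm_real, Real.norm_of_nonneg (mul_nonneg (by positivity) (ha i).le)]
      ring
    simp only [h1]
    rw [← Finset.mul_sum, Real.sqrt_mul (sq_nonneg _), Real.sqrt_sq (by positivity),
      inv_mul_le_one₀ (Real.sqrt_pos.2 hcpos)]
    exact hR x hx
  obtain ⟨F, hF, hFR, F0, F1⟩ := exists_of_interpN_lt ((interpN_opN_le_dTheta hθ hθ1 hl₀ hl₁
    hRop).trans_lt (lt_add_of_pos_right _ hε))
  set d := dTheta θ (l2nNorm NE₀ : (Fin n → V) → ℝ) (l2nNorm NE₁)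
  have hd : 0 ≤ d := dTheta_nonneg hl₀.1
  let G : ℂ → Hilb →L[ℂ] Fin n → V := fun z =>
    (diagCLM fun i => (√c : ℂ) * geomWeight (w₀ i) (w₁ i) z).comp (F z)
  have hG : FinType G := hF.diagCLM_comp fun i => (Adm.const _).mul (adm_geomWeight _ _)
  have hGT : G θ = T := by
    ext x i
    change ((√c : ℂ) * geomWeight (w₀ i) (w₁ i) θ) • F θ x i = T x i
    rw [hFR]
    change _ • (((√c)⁻¹ * a i : ℝ) : ℂ) • T x i = T x i
    rw [smul_smul, geomWeight_theta hθ hθ1 (hw₀ i).le (hw₁ i).le, ← Complex.ofReal_mul,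
      ← Complex.ofReal_mul, show √c * (w₀ i ^ (1 - θ) * w₁ i ^ θ) * ((√c)⁻¹ * a i) =
        (√c * (√c)⁻¹) * (a i * (w₀ i ^ (1 - θ) * w₁ i ^ θ)) by ring, haw, mul_inv_cancel₀ hsc]
    simp
  have hnorm : ∀ {g : ℂ} {w : ℝ}, ‖g‖ ≤ w → ‖(√c : ℂ) * g‖ ≤ √c * w := fun h => by
    rw [norm_mul, Complex.norm_real, Real.norm_of_nonneg (Real.sqrt_nonneg _)]
    exact mul_le_mul_of_nonneg_left h (Real.sqrt_nonneg _)
  obtain ⟨κ₀, hκ₀, hκ₀'⟩ := hl₀.exists_le_norm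
  obtain ⟨κ₁, hκ₁, hκ₁'⟩ := hl₁.exists_le_norm
  rw [← hGT]
  refine interpN_le (fun S => opN_nonneg hv₀.1 S) hG (fun t => ?_) (fun t => ?_)
  · exact opN_le (by positivity) fun x hx => vecLatNorm_smul_le hX₀ h₀ hcpos.le hb₀
      (fun i => hnorm (norm_geomWeight_left _ (hw₀ i).le t))
      ((le_opN hκ₀.le hκ₀' _ hx).trans (F0 t))
  · exact opN_le (by positivity) fun x hx => vecLatNorm_smul_le hX₁ h₁ hcpos.le hb₁
      (fun i => hnorm (norm_geomWeight_right _ (hw₁ i).le t))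
      ((le_opN hκ₁.le hκ₁' _ hx).trans (F1 t))

end Main

/-- Proposition 3:
`d_θ[X₀(E₀),X₁(E₁)] ≤ √2·C₂([E₀,E₁]_θ)·M_(2)(X₀)^{1-θ}·M_(2)(X₁)^θ·d_θ[ℓ₂ⁿ(E₀),ℓ₂ⁿ(E₁)]`. -/
theorem statement15 {n k : ℕ} (θ : ℝ) (hθ : 0 < θ) (hθ1 : θ < 1)
    (NX₀ NX₁ : (Fin n → ℝ) → ℝ)
    (hX₀ : IsLatticeNorm NX₀) (hX₁ : IsLatticeNorm NX₁)
    (M₀ M₁ : ℝ) (hM₀ : 0 ≤ M₀) (hM₁ : 0 ≤ M₁)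
    (hc₀ : ConcaveWith 2 M₀ NX₀) (hc₁ : ConcaveWith 2 M₁ NX₁)
    (NE₀ NE₁ : (Fin k → ℂ) → ℝ) (hE₀ : IsNormC NE₀) (hE₁ : IsNormC NE₁)
    (C : ℝ) (hC : 0 ≤ C) (hcot : Cotype2With (interpN θ NE₀ NE₁) C) :
    dTheta θ (vecLatNorm NX₀ NE₀) (vecLatNorm NX₁ NE₁) ≤
      Real.sqrt 2 * C * M₀ ^ (1 - θ) * M₁ ^ θ *
        dTheta θ (l2nNorm NE₀ : (Fin n → Fin k → ℂ) → ℝ)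
          (l2nNorm NE₁ : (Fin n → Fin k → ℂ) → ℝ) := by
  refine Real.sSup_le ?_ (mul_nonneg (by positivity) (dTheta_nonneg (isNormC_l2nNorm hE₀).1))
  rintro _ ⟨T, hT, rfl⟩
  have := le_of_forall_pos_le_of_continuous
    (f := fun η => (√2 * C * M₀ ^ (1 - θ) * M₁ ^ θ + η) *
      (dTheta θ (l2nNorm NE₀ : (Fin n → Fin k → ℂ) → ℝ) (l2nNorm NE₁) + η)) (by fun_prop)
    fun η hη => interpN_opN_le hθ hθ1 hX₀ hX₁ hM₀ hM₁ hc₀ hc₁ hE₀ hE₁ hC hcot hT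
      (lt_add_of_pos_right _ hη) hη
  simpa using this

end Paper
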